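/- arXiv:1810.09307 — 4 statements merged into one kernel-verified Lean document; each statement's English description precedes it below -/
import Mathlib

section
/- Let n ≥ 2. The rank of the monoid End P_n (i.e. the minimum cardinality of a generating set of End P_n) is equal to 1 + ⌊(n−1)/2⌋ + Σ_{j=1}^{⌊(n−3)/3⌋} ⌊(n−3j−1)/2⌋. -/
/-- `α` is a weak endomorphism of the path `P_n` (with vertices `0,…,n-1` standing for
`1,…,n`): `|iα - (i+1)α| ≤ 1` for all consecutive pairs of vertices. -/
def IsWEndo {n : ℕ} (f : Function.End (Fin n)) : Prop :=
  ∀ i : ℕ, ∀ h : i + 1 < n,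
    |(((f ⟨i, by omega⟩ : Fin n) : ℕ) : ℤ) - (((f ⟨i + 1, h⟩ : Fin n) : ℕ) : ℤ)| ≤ 1

/-- `α` is an endomorphism of the path `P_n`: `|iα - (i+1)α| = 1` for all consecutive
pairs of vertices. -/
def IsEndo {n : ℕ} (f : Function.End (Fin n)) : Prop :=
  ∀ i : ℕ, ∀ h : i + 1 < n,
    |(((f ⟨i, by omega⟩ : Fin n) : ℕ) : ℤ) - (((f ⟨i + 1, h⟩ : Fin n) : ℕ) : ℤ)| = 1

namespace PathEnd

variable {N : ℕ}

/-- The values of a transformation of `{0,…,N}`, as an integer function (constant outside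
`[0, N]`). -/
def ev (α : Function.End (Fin (N + 1))) (x : ℤ) : ℤ :=
  ((α ⟨min x.toNat N, by omega⟩ : Fin (N + 1)) : ℕ)

/-- The transformation of `{0,…,N}` given by an integer function, truncated to `[0, N]`. -/
def ofInt (N : ℕ) (g : ℤ → ℤ) : Function.End (Fin (N + 1)) :=
  fun i => ⟨min (g (i : ℕ)).toNat N, by omega⟩

/-- Consecutive values of `f` at the points of `[a, b]` differ by one. -/
def WalkOn (f : ℤ → ℤ) (a b : ℤ) : Prop :=
  ∀ x, a ≤ x → x < b → f (x + 1) = f x + 1 ∨ f (x + 1) = f x - 1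

/-- The interior points at which a transformation of the path turns back. -/
noncomputable def turns (α : Function.End (Fin (N + 1))) : Finset ℤ :=
  {x ∈ Finset.Ioo (0 : ℤ) N | ev α (x - 1) = ev α (x + 1)}

/-- The nontrivial automorphism of the path. -/
def rev (N : ℕ) : Function.End (Fin (N + 1)) := ofInt N fun x => N - x

/-- For `j = 0` the fold at `A`, otherwise the zigzag turning at `A` and `A + j`. -/
def zigzag (j A : ℤ) (x : ℤ) : ℤ :=
  if j = 0 then (if x ≤ A then A - x else x - A)
  else if x ≤ A then x else if x ≤ A + j then 2 * A - x else x - 2 * j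

lemma ev_nonneg (α : Function.End (Fin (N + 1))) (x : ℤ) : 0 ≤ ev α x := by
  unfold ev; omega

lemma ev_le (α : Function.End (Fin (N + 1))) (x : ℤ) : ev α x ≤ N := by
  unfold ev
  have := (α ⟨min x.toNat N, by omega⟩ : Fin (N + 1)).isLt
  omega

lemma ev_coe (α : Function.End (Fin (N + 1))) (i : Fin (N + 1)) :
    ev α (i : ℕ) = ((α i : Fin (N + 1)) : ℕ) := by
  have : (⟨min ((i : ℕ) : ℤ).toNat N, by omega⟩ : Fin (N + 1)) = i := by
    ext; simp; omega
  rw [ev, this]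

lemma ev_ext {α β : Function.End (Fin (N + 1))}
    (h : ∀ x : ℤ, 0 ≤ x → x ≤ N → ev α x = ev β x) : α = β := by
  funext i
  have := h (i : ℕ) (by omega) (by omega)
  rw [ev_coe, ev_coe] at this
  ext
  exact_mod_cast this

lemma ev_mul (α β : Function.End (Fin (N + 1))) (x : ℤ) :
    ev (α * β) x = ev α (ev β x) := by
  conv_rhs => rw [ev.eq_def β, ev_coe]
  rfl

lemma ev_one {x : ℤ} (h0 : 0 ≤ x) (h1 : x ≤ N) :
    ev (1 : Function.End (Fin (N + 1))) x = x := by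
  change ((min x.toNat N : ℕ) : ℤ) = x
  omega

lemma ev_ofInt {g : ℤ → ℤ} {x : ℤ} (h0 : 0 ≤ x) (h1 : x ≤ N) (h2 : 0 ≤ g x) (h3 : g x ≤ N) :
    ev (ofInt N g) x = g x := by
  have hx : ((min x.toNat N : ℕ) : ℤ) = x := by omega
  change ((min (g ((min x.toNat N : ℕ) : ℤ)).toNat N : ℕ) : ℤ) = g x
  rw [hx]
  omega

lemma ev_rev {x : ℤ} (h0 : 0 ≤ x) (h1 : x ≤ N) : ev (rev N) x = N - x :=
  ev_ofInt h0 h1 (by omega) (by omega)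

lemma isEndo_iff (α : Function.End (Fin (N + 1))) : IsEndo α ↔ WalkOn (ev α) 0 N := by
  constructor
  · intro h x h0 h1
    have := h x.toNat (by omega)
    rw [← ev_coe, ← ev_coe] at this
    have e1 : ((x.toNat : ℕ) : ℤ) = x := by omega
    simp only [Nat.cast_add, e1, Nat.cast_one] at this
    rcases (abs_eq (by norm_num)).1 this with h | h <;> omega
  · intro h i hi
    have := h i (by omega) (by omega)
    rw [← ev_coe, ← ev_coe, abs_eq (by norm_num)]
    simp only [Nat.cast_add, Nat.cast_one]
    omega

lemma isEndo_mul {α β : Function.End (Fin (N + 1))} (hα : IsEndo α) (hβ : IsEndo β) :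
    IsEndo (α * β) := by
  rw [isEndo_iff] at *
  intro x h0 h1
  rw [ev_mul, ev_mul]
  have l1 := ev_nonneg β x
  have l2 := ev_nonneg β (x + 1)
  have l3 := ev_le β x
  have l4 := ev_le β (x + 1)
  rcases hβ x h0 h1 with h | h
  · rw [h] at l4 ⊢
    exact hα _ l1 (by omega)
  · have := hα (ev β (x + 1)) l2 (by omega)
    rw [show ev β (x + 1) + 1 = ev β x by omega] at this
    omega

lemma isEndo_one : IsEndo (1 : Function.End (Fin (N + 1))) := by
  rw [isEndo_iff]
  intro x h0 h1
  rw [ev_one (by omega) (by omega), ev_one (by omega) (by omega)]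
  omega

lemma isEndo_rev : IsEndo (rev N) := by
  rw [isEndo_iff]
  intro x h0 h1
  rw [ev_rev (by omega) (by omega), ev_rev (by omega) (by omega)]
  omega

lemma rev_mul_rev : rev N * rev N = 1 := by
  apply ev_ext
  intro x h0 h1
  rw [ev_mul, ev_rev h0 h1, ev_rev (by omega) (by omega), ev_one h0 h1]
  omega

lemma rev_ne_one (hN : 1 ≤ N) : rev N ≠ 1 := by
  intro h
  have := ev_rev (N := N) (x := 0) le_rfl (by omega)
  rw [h, ev_one le_rfl (by omega)] at this
  omega

lemma mem_turns {α : Function.End (Fin (N + 1))} {x : ℤ} :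
    x ∈ turns α ↔ (0 < x ∧ x < N) ∧ ev α (x - 1) = ev α (x + 1) := by
  simp [turns]

lemma turns_rev : turns (rev N) = ∅ := by
  ext x
  simp only [mem_turns, Finset.notMem_empty, iff_false, not_and]
  intro h
  rw [ev_rev (by omega) (by omega), ev_rev (by omega) (by omega)]
  omega

lemma turns_one : turns (1 : Function.End (Fin (N + 1))) = ∅ := by
  ext x
  simp only [mem_turns, Finset.notMem_empty, iff_false, not_and]
  intro h
  rw [ev_one (by omega) (by omega), ev_one (by omega) (by omega)]
  omega

lemma mem_turns_mul_rev {α : Function.End (Fin (N + 1))} {x : ℤ} :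
    x ∈ turns (α * rev N) ↔ N - x ∈ turns α := by
  simp only [mem_turns, ev_mul]
  by_cases h : 0 < x ∧ x < N
  · rw [ev_rev (by omega) (by omega), ev_rev (by omega) (by omega),
      show (N : ℤ) - (x - 1) = N - x + 1 by ring, show (N : ℤ) - (x + 1) = N - x - 1 by ring]
    constructor
    · rintro ⟨-, h2⟩; exact ⟨by omega, h2.symm⟩
    · rintro ⟨-, h2⟩; exact ⟨h, h2.symm⟩
  · constructor
    · rintro ⟨h1, -⟩; omega
    · rintro ⟨h1, -⟩; omega

lemma turns_subset_turns_mul (α β : Function.End (Fin (N + 1))) :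
    turns β ⊆ turns (α * β) := by
  intro x hx
  rw [mem_turns] at *
  exact ⟨hx.1, by rw [ev_mul, ev_mul, hx.2]⟩

lemma mem_turns_mul_iff {α β : Function.End (Fin (N + 1))} (hβ : IsEndo β) {x : ℤ}
    (h0 : 0 < x) (h1 : x < N) (hx : x ∉ turns β) :
    x ∈ turns (α * β) ↔ ev β x ∈ turns α := by
  rw [isEndo_iff] at hβ
  have w1 := hβ (x - 1) (by omega) (by omega)
  have w2 := hβ x (by omega) (by omega)
  rw [sub_add_cancel] at w1
  rw [mem_turns] at hx ⊢
  rw [mem_turns, ev_mul, ev_mul]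
  have l1 := ev_nonneg β (x - 1)
  have l2 := ev_nonneg β (x + 1)
  have l3 := ev_le β (x - 1)
  have l4 := ev_le β (x + 1)
  have hne : ev β (x - 1) ≠ ev β (x + 1) := fun h => hx ⟨⟨h0, h1⟩, h⟩
  rcases w1 with w1 | w1 <;> rcases w2 with w2 | w2
  · have e : ev β (x - 1) = ev β x - 1 := by omega
    rw [e, w2]
    exact and_congr_left fun _ => by omega
  · omega
  · omega
  · have e : ev β (x - 1) = ev β x + 1 := by omega
    rw [e, w2, eq_comm]
    exact and_congr_left fun _ => by omega

lemma WalkOn.straight {f : ℤ → ℤ} {a b : ℤ} (hf : WalkOn f a b) (hab : a < b)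
    (ht : ∀ x, a < x → x < b → f (x - 1) ≠ f (x + 1)) :
    (∀ x, a ≤ x → x ≤ b → f x = f a + (x - a)) ∨
      ∀ x, a ≤ x → x ≤ b → f x = f a - (x - a) := by
  have key : ∀ k : ℕ, a + k + 1 ≤ b →
      f (a + k + 1) - f (a + k) = f (a + 1) - f a := by
    intro k
    induction k with
    | zero => intro _; simp
    | succ k ih =>
      intro h
      push_cast at h ⊢
      have h1 := ih (by omega)
      have w1 := hf (a + k) (by omega) (by omega)
      have w2 := hf (a + k + 1) (by omega) (by omega)
      have h3 := ht (a + k + 1) (by omega) (by omega)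
      rw [add_sub_cancel_right] at h3
      rw [← add_assoc]
      omega
  rcases hf a le_rfl hab with h | h
  · left
    intro x h0
    induction x, h0 using Int.leInduction with
    | base => intro _; simp
    | succ x hx ih =>
      intro hb
      have h1 := ih (by omega)
      have h2 := key (x - a).toNat (by omega)
      rw [show a + ((x - a).toNat : ℤ) = x by omega] at h2
      omega
  · right
    intro x h0
    induction x, h0 using Int.leInduction with
    | base => intro _; simp
    | succ x hx ih =>
      intro hb
      have h1 := ih (by omega)
      have h2 := key (x - a).toNat (by omega)
      rw [show a + ((x - a).toNat : ℤ) = x by omega] at h2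
      omega

lemma WalkOn.reflect {f : ℤ → ℤ} {r m : ℤ} (hf : WalkOn f (r - m) (r + m))
    (hr : f (r - 1) = f (r + 1))
    (ht : ∀ x, r - m < x → x < r + m → x ≠ r → f (x - 1) ≠ f (x + 1)) :
    ∀ y, 0 ≤ y → y ≤ m → f (r - y) = f (r + y) := by
  have key : ∀ k : ℕ, (k : ℤ) + 1 ≤ m →
      f (r - k) = f (r + k) ∧ f (r - k - 1) = f (r + k + 1) := by
    intro k
    induction k with
    | zero => intro _; simpa using hr
    | succ k ih =>
      intro h
      push_cast at h ⊢
      obtain ⟨h1, h2⟩ := ih (by omega)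
      have w1 := hf (r + k) (by omega) (by omega)
      have w2 := hf (r + k + 1) (by omega) (by omega)
      have w3 := hf (r - k - 1) (by omega) (by omega)
      have w4 := hf (r - k - 1 - 1) (by omega) (by omega)
      have t1 := ht (r + k + 1) (by omega) (by omega) (by omega)
      have t2 := ht (r - k - 1) (by omega) (by omega) (by omega)
      rw [add_sub_cancel_right] at t1
      rw [sub_add_cancel] at w3 w4 t2
      rw [show r - ((k : ℤ) + 1) = r - k - 1 by ring, show r + ((k : ℤ) + 1) = r + k + 1 by ring]
      omega
  intro y h0 h1
  rcases h0.eq_or_lt with h | h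
  · subst h; simp
  · have := (key (y - 1).toNat (by omega)).2
    rw [show ((y - 1).toNat : ℤ) = y - 1 by omega] at this
    convert this using 2 <;> ring

lemma eq_one_or_rev {α : Function.End (Fin (N + 1))} (hN : 1 ≤ N) (hα : IsEndo α)
    (h : turns α = ∅) : α = 1 ∨ α = rev N := by
  have hw := (isEndo_iff α).1 hα
  have ht : ∀ x, 0 < x → x < (N : ℤ) → ev α (x - 1) ≠ ev α (x + 1) := by
    intro x h0 h1 he
    have : x ∈ turns α := mem_turns.2 ⟨⟨h0, h1⟩, he⟩
    simp [h] at this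
  have l1 := ev_nonneg α 0
  have l2 := ev_le α 0
  have l3 := ev_nonneg α N
  have l4 := ev_le α N
  rcases hw.straight (by omega) ht with hs | hs
  · left
    have := hs N (by omega) le_rfl
    refine ev_ext fun x h0 h1 => ?_
    rw [ev_one h0 h1, hs x h0 h1]
    omega
  · right
    have := hs N (by omega) le_rfl
    refine ev_ext fun x h0 h1 => ?_
    rw [ev_rev h0 h1, hs x h0 h1]
    omega

/-! ### Irreducible classes -/

/-- The transformations with the turning points of a zigzag, up to reversal of the path. -/
def zigzagClass (N : ℕ) (j A : ℤ) : Set (Function.End (Fin (N + 1))) :=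
  {α | turns α = {A, A + j} ∨ turns α = {N - A - j, N - A}}

lemma turns_right_factor {α β : Function.End (Fin (N + 1))} (hβ : IsEndo β) {j A : ℤ}
    (hj : 0 ≤ j) (hjA : j < A) (hA : A + 2 * j < N) (h : turns (α * β) = {A, A + j}) :
    turns β = {A, A + j} ∨ turns β = ∅ := by
  have hw := (isEndo_iff β).1 hβ
  have hsub := turns_subset_turns_mul α β
  rw [h] at hsub
  have no_turn : ∀ x, 0 < x → x < (N : ℤ) → x ∉ turns β → ev β (x - 1) ≠ ev β (x + 1) :=
    fun x h0 h1 hx he => hx (mem_turns.2 ⟨⟨h0, h1⟩, he⟩)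
  -- a turn at exactly one of the two points would be copied to a third point by reflection
  have key : ∀ r s t : ℤ, r ∈ turns β → s ∉ turns β → s ∈ turns (α * β) → t ∉ turns (α * β) →
      (∀ x ∈ turns β, x = r) → 0 < t → t < N → 0 < s → s < N → r - j = t ∧ r + j = s ∨
      r - j = s ∧ r + j = t → False := by
    intro r s t hr hs hs' ht' huniq ht0 ht1 hs0 hs1 hst
    have htβ : t ∉ turns β := fun ht => ht' (turns_subset_turns_mul α β ht)
    have hrefl := WalkOn.reflect (f := ev β) (r := r) (m := j)
      (fun x h0 h1 => hw x (by omega) (by omega)) (mem_turns.1 hr).2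
      (fun x h0 h1 hx => no_turn x (by omega) (by omega) fun hx' => hx (huniq x hx')) j hj le_rfl
    have heq : ev β s = ev β t := by
      rcases hst with ⟨rfl, rfl⟩ | ⟨rfl, rfl⟩
      · exact hrefl.symm
      · exact hrefl
    rw [mem_turns_mul_iff hβ hs0 hs1 hs, heq, ← mem_turns_mul_iff hβ ht0 ht1 htβ] at hs'
    exact ht' hs'
  by_cases h1 : A ∈ turns β <;> by_cases h2 : A + j ∈ turns β
  · left
    refine Finset.Subset.antisymm hsub ?_
    intro x hx
    simp only [Finset.mem_insert, Finset.mem_singleton] at hx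
    rcases hx with rfl | rfl <;> assumption
  · exfalso
    have hj0 : j ≠ 0 := by rintro rfl; simp at h2; exact h2 h1
    refine key A (A + j) (A - j) h1 h2 (by simp [h]) ?_ ?_ (by omega) (by omega) (by omega)
      (by omega) (Or.inl ⟨rfl, rfl⟩)
    · rw [h]; simp only [Finset.mem_insert, Finset.mem_singleton]; omega
    · intro x hx
      have := hsub hx
      simp only [Finset.mem_insert, Finset.mem_singleton] at this
      rcases this with h | rfl
      · exact h
      · exact absurd hx h2
  · exfalso
    have hj0 : j ≠ 0 := by rintro rfl; simp at h2; exact h1 h2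
    refine key (A + j) A (A + 2 * j) h2 h1 (by simp [h]) ?_ ?_ (by omega) (by omega) (by omega)
      (by omega) (Or.inr ⟨by ring, by ring⟩)
    · rw [h]; simp only [Finset.mem_insert, Finset.mem_singleton]; omega
    · intro x hx
      have := hsub hx
      simp only [Finset.mem_insert, Finset.mem_singleton] at this
      rcases this with rfl | h
      · exact absurd hx h1
      · exact h
  · right
    refine Finset.eq_empty_of_forall_notMem fun x hx => ?_
    have := hsub hx
    simp only [Finset.mem_insert, Finset.mem_singleton] at this
    rcases this with rfl | rfl <;> contradiction

lemma turns_mul_rev_eq {α : Function.End (Fin (N + 1))} {a b : ℤ}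
    (h : turns (α * rev N) = {a, b}) : turns α = {N - b, N - a} := by
  ext x
  have := mem_turns_mul_rev (α := α) (x := N - x)
  rw [sub_sub_cancel] at this
  rw [← this, h]
  simp only [Finset.mem_insert, Finset.mem_singleton]
  omega

lemma zigzagClass_prime (hN : 1 ≤ N) {j A : ℤ} (hj : 0 ≤ j) (hjA : j < A)
    (hA : 2 * A + j ≤ N) {α β : Function.End (Fin (N + 1))} (hβ : IsEndo β)
    (h : α * β ∈ zigzagClass N j A) : α ∈ zigzagClass N j A ∨ β ∈ zigzagClass N j A := by
  have hfac : β ∈ zigzagClass N j A ∨ turns β = ∅ := by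
    rcases h with h | h
    · exact (turns_right_factor hβ hj hjA (by omega) h).imp_left Or.inl
    · have e : (N : ℤ) - A - j + j = N - A := by ring
      have h' : turns (α * β) = {(N : ℤ) - A - j, N - A - j + j} := by rw [e, h]
      refine (turns_right_factor hβ hj (by omega) (by omega) h').imp_left fun h => Or.inr ?_
      rw [h, e]
  rcases hfac with h' | h'
  · exact Or.inr h'
  left
  rcases eq_one_or_rev hN hβ h' with rfl | rfl
  · rwa [mul_one] at h
  · rcases h with h | h
    · right
      rw [turns_mul_rev_eq h, sub_add_eq_sub_sub]
    · left
      rw [turns_mul_rev_eq h]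
      congr 2 <;> ring

lemma exists_mem_of_prime {S C : Set (Function.End (Fin (N + 1)))}
    (hS : (Submonoid.closure S : Set (Function.End (Fin (N + 1)))) = {f | IsEndo f})
    (hone : 1 ∉ C)
    (hC : ∀ α β : Function.End (Fin (N + 1)), IsEndo α → IsEndo β → α * β ∈ C → α ∈ C ∨ β ∈ C)
    {γ : Function.End (Fin (N + 1))} (hγ : IsEndo γ) (hγC : γ ∈ C) : ∃ s ∈ S, s ∈ C := by
  have hmem : ∀ x, x ∈ Submonoid.closure S ↔ IsEndo x := fun x => Set.ext_iff.1 hS x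
  have := (hmem γ).2 hγ
  induction this using Submonoid.closure_induction with
  | mem x hx => exact ⟨x, hx, hγC⟩
  | one => exact absurd hγC hone
  | mul x y hx hy ihx ihy =>
    rcases hC x y ((hmem x).1 hx) ((hmem y).1 hy) hγC with h | h
    · exact ihx ((hmem x).1 hx) h
    · exact ihy ((hmem y).1 hy) h

lemma rev_prime (hN : 1 ≤ N) {α β : Function.End (Fin (N + 1))} (hβ : IsEndo β)
    (h : α * β ∈ ({rev N} : Set (Function.End (Fin (N + 1))))) :
    α ∈ ({rev N} : Set (Function.End (Fin (N + 1)))) ∨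
      β ∈ ({rev N} : Set (Function.End (Fin (N + 1)))) := by
  rw [Set.mem_singleton_iff] at *
  have h' : turns β = ∅ := by
    have := turns_subset_turns_mul α β
    rw [h, turns_rev] at this
    exact Finset.subset_empty.1 this
  rcases eq_one_or_rev hN hβ h' with rfl | rfl
  · left; rwa [mul_one] at h
  · right; rfl

/-! ### The generators -/

/-- The parameters of the standard generators. -/
def params (N : ℕ) : Finset (Σ _ : ℕ, ℕ) :=
  (Finset.range ((N + 1 - 3) / 3 + 1)).sigma fun j => Finset.Icc (j + 1) ((N - j) / 2)

lemma mem_params {p : Σ _ : ℕ, ℕ} : p ∈ params N ↔ p.1 < p.2 ∧ 2 * p.2 + p.1 ≤ N := by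
  rw [params, Finset.mem_sigma, Finset.mem_range, Finset.mem_Icc]
  omega

lemma card_params (N : ℕ) :
    (params N).card = N / 2 + ∑ j ∈ Finset.Icc 1 ((N + 1 - 3) / 3), (N + 1 - 3 * j - 1) / 2 := by
  rw [params, Finset.card_sigma, Finset.range_eq_Ico,
    Finset.sum_eq_sum_Ico_succ_bot (by omega), add_comm 0 1]
  congr 1
  · simp
  · refine Finset.sum_congr rfl fun j hj => ?_
    rw [Nat.card_Icc]
    omega

lemma zigzag_mem_Icc {j A x : ℤ} (hj : 0 ≤ j) (hjA : j < A) (hA : A + 2 * j ≤ N)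
    (h0 : 0 ≤ x) (h1 : x ≤ N) : 0 ≤ zigzag j A x ∧ zigzag j A x ≤ N := by
  unfold zigzag
  split_ifs <;> omega

lemma ev_zigzag {j A x : ℤ} (hj : 0 ≤ j) (hjA : j < A) (hA : A + 2 * j ≤ N)
    (h0 : 0 ≤ x) (h1 : x ≤ N) : ev (ofInt N (zigzag j A)) x = zigzag j A x := by
  have := zigzag_mem_Icc hj hjA hA h0 h1
  exact ev_ofInt h0 h1 this.1 this.2

lemma isEndo_zigzag {j A : ℤ} (hj : 0 ≤ j) (hjA : j < A) (hA : A + 2 * j ≤ N) :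
    IsEndo (ofInt N (zigzag j A)) := by
  rw [isEndo_iff]
  intro x h0 h1
  rw [ev_zigzag hj hjA hA (by omega) (by omega), ev_zigzag hj hjA hA (by omega) (by omega)]
  unfold zigzag
  split_ifs <;> omega

lemma turns_zigzag {j A : ℤ} (hj : 0 ≤ j) (hjA : j < A) (hA : A + 2 * j ≤ N)
    (hA2 : A + j < N) : turns (ofInt N (zigzag j A)) = {A, A + j} := by
  ext x
  rw [mem_turns]
  simp only [Finset.mem_insert, Finset.mem_singleton]
  by_cases h : 0 < x ∧ x < N
  · rw [ev_zigzag hj hjA hA (by omega) (by omega), ev_zigzag hj hjA hA (by omega) (by omega)]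
    unfold zigzag
    split_ifs <;> omega
  · omega

lemma zigzagClass_injective {j A k B : ℤ} (hj : 0 ≤ j) (hA : 2 * A + j ≤ N)
    (hk : 0 ≤ k) (hB : 2 * B + k ≤ N) {α : Function.End (Fin (N + 1))}
    (h : α ∈ zigzagClass N j A) (h' : α ∈ zigzagClass N k B) : j = k ∧ A = B := by
  have pair : ∀ a b c d : ℤ, ({a, b} : Finset ℤ) = {c, d} → a ≤ b → c ≤ d → a = c ∧ b = d := by
    intro a b c d he hab hcd
    have e := Finset.ext_iff.1 he
    simp only [Finset.mem_insert, Finset.mem_singleton] at e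
    have e1 := e a
    have e2 := e b
    have e3 := e c
    have e4 := e d
    omega
  rcases h with h | h <;> rcases h' with h' | h' <;> rw [h] at h' <;>
    have := pair _ _ _ _ h' (by omega) (by omega) <;> omega

/-- Every generating set has at least as many elements as the standard one. -/
lemma le_ncard (hN : 1 ≤ N) {S : Set (Function.End (Fin (N + 1)))}
    (hS : (Submonoid.closure S : Set (Function.End (Fin (N + 1)))) = {f | IsEndo f}) :
    (params N).card + 1 ≤ S.ncard := by
  classical
  have hex : ∀ p : Σ _ : ℕ, ℕ, ∃ s, p ∈ params N → s ∈ S ∧ s ∈ zigzagClass N p.1 p.2 := by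
    intro p
    by_cases hp : p ∈ params N
    · obtain ⟨h1, h2⟩ := mem_params.1 hp
      obtain ⟨s, hs⟩ := exists_mem_of_prime (C := zigzagClass N p.1 p.2) hS
        (by
          rintro (h | h) <;> rw [turns_one] at h
          · exact absurd h.symm (Finset.insert_ne_empty _ _)
          · exact absurd h.symm (Finset.insert_ne_empty _ _))
        (fun α β _ hβ h => zigzagClass_prime hN (by omega) (by omega) (by omega) hβ h)
        (isEndo_zigzag (j := p.1) (A := p.2) (by omega) (by omega) (by omega))
        (Or.inl (turns_zigzag (by omega) (by omega) (by omega) (by omega)))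
      exact ⟨s, fun _ => hs⟩
    · exact ⟨1, fun h => absurd h hp⟩
  choose F hF using hex
  obtain ⟨s, hs, rfl⟩ : ∃ s ∈ S, s ∈ ({rev N} : Set (Function.End (Fin (N + 1)))) :=
    exists_mem_of_prime hS (fun h => rev_ne_one hN h.symm)
      (fun α β _ hβ h => rev_prime hN hβ h) isEndo_rev rfl
  have hinj : Set.InjOn F (params N) := by
    intro p hp q hq hpq
    have h1 := (hF p hp).2
    have h2 := (hF q hq).2
    rw [← hpq] at h2
    obtain ⟨a1, a2⟩ := mem_params.1 hp
    obtain ⟨b1, b2⟩ := mem_params.1 hq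
    have := zigzagClass_injective (by omega) (by omega) (by omega) (by omega) h1 h2
    rcases p with ⟨p1, p2⟩
    rcases q with ⟨q1, q2⟩
    simp only [Nat.cast_inj] at this
    rw [this.1, this.2]
  have hnot : rev N ∉ (params N).image F := by
    intro h
    obtain ⟨p, hp, h⟩ := Finset.mem_image.1 h
    have h1 := (hF p hp).2
    rw [h] at h1
    rcases h1 with h1 | h1 <;> rw [turns_rev] at h1
    · exact absurd h1.symm (Finset.insert_ne_empty _ _)
    · exact absurd h1.symm (Finset.insert_ne_empty _ _)
  have hcard : (insert (rev N) ((params N).image F)).card = (params N).card + 1 := by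
    rw [Finset.card_insert_of_notMem hnot, Finset.card_image_of_injOn hinj]
  have : Finite (Function.End (Fin (N + 1))) := inferInstanceAs (Finite (Fin (N + 1) → Fin (N + 1)))
  rw [← hcard, ← Set.ncard_coe_finset]
  refine Set.ncard_le_ncard ?_ (Set.toFinite S)
  intro x hx
  simp only [Finset.coe_insert, Finset.coe_image, Set.mem_insert_iff, Set.mem_image,
    Finset.mem_coe] at hx
  rcases hx with rfl | ⟨p, hp, rfl⟩
  · exact hs
  · exact (hF p hp).1

/-! ### Generation -/

/-- A submonoid contains the standard generators. -/
structure ContainsGens (M : Submonoid (Function.End (Fin (N + 1)))) : Prop where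
  rev_mem : rev N ∈ M
  zigzag_mem : ∀ j A : ℤ, 0 ≤ j → j < A → 2 * A + j ≤ N → ofInt N (zigzag j A) ∈ M

variable {M : Submonoid (Function.End (Fin (N + 1)))}

lemma ContainsGens.exists_shift (hM : ContainsGens M) (hN : 1 ≤ N) :
    ∃ τ ∈ M, ∀ x, 0 ≤ x → x < (N : ℤ) → ev τ x = x + 1 := by
  rcases hN.eq_or_lt with rfl | h
  · refine ⟨rev 1, hM.rev_mem, fun x h0 h1 => ?_⟩
    rw [ev_rev h0 (by omega)]
    omega
  · refine ⟨rev N * ofInt N (zigzag 0 1) * rev N,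
      mul_mem (mul_mem hM.rev_mem (hM.zigzag_mem 0 1 le_rfl (by omega) (by omega))) hM.rev_mem,
      fun x h0 h1 => ?_⟩
    rw [ev_mul, ev_mul, ev_rev h0 (by omega),
      ev_zigzag (by omega) (by omega) (by omega) (by omega) (by omega)]
    have : zigzag 0 1 (N - x) = N - x - 1 := by
      unfold zigzag; split_ifs <;> omega
    rw [this, ev_rev (by omega) (by omega)]
    omega

lemma ContainsGens.mem_of_add_nat (hM : ContainsGens M) (hN : 1 ≤ N) (k : ℕ) :
    ∀ {α β : Function.End (Fin (N + 1))}, α ∈ M →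
      (∀ x, 0 ≤ x → x ≤ (N : ℤ) → ev β x = ev α x + k) → β ∈ M := by
  obtain ⟨τ, hτ, hτx⟩ := hM.exists_shift hN
  induction k with
  | zero =>
    intro α β hα h
    have : β = α := ev_ext fun x h0 h1 => by simpa using h x h0 h1
    rwa [this]
  | succ k ih =>
    intro α β hα h
    refine ih (mul_mem hτ hα) fun x h0 h1 => ?_
    have h2 := h x h0 h1
    have h3 := ev_le β x
    rw [ev_mul, hτx _ (ev_nonneg α x) (by omega)]
    omega

lemma ContainsGens.mem_of_add (hM : ContainsGens M) (hN : 1 ≤ N) (c : ℤ)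
    {α β : Function.End (Fin (N + 1))} (hα : α ∈ M)
    (h : ∀ x, 0 ≤ x → x ≤ (N : ℤ) → ev β x = ev α x + c) : β ∈ M := by
  rcases le_total 0 c with hc | hc
  · refine hM.mem_of_add_nat hN c.toNat hα fun x h0 h1 => ?_
    have := h x h0 h1
    omega
  · have : rev N * β ∈ M := by
      refine hM.mem_of_add_nat hN (-c).toNat (mul_mem hM.rev_mem hα) fun x h0 h1 => ?_
      have := h x h0 h1
      rw [ev_mul, ev_mul, ev_rev (ev_nonneg _ _) (ev_le _ _), ev_rev (ev_nonneg _ _) (ev_le _ _)]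
      omega
    have := mul_mem hM.rev_mem this
    rwa [← mul_assoc, rev_mul_rev, one_mul] at this

lemma ContainsGens.zigzag_mem' (hM : ContainsGens M) (hN : 1 ≤ N) {j A : ℤ} (hj : 0 < j)
    (hjA : j < A) (hA : A + 2 * j < N) : ofInt N (zigzag j A) ∈ M := by
  by_cases h : 2 * A + j ≤ N
  · exact hM.zigzag_mem j A hj.le hjA h
  · refine hM.mem_of_add hN (-(2 * j))
      (mul_mem (mul_mem hM.rev_mem (hM.zigzag_mem j (N - A - j) hj.le (by omega) (by omega)))
        hM.rev_mem) fun x h0 h1 => ?_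
    rw [ev_mul, ev_mul, ev_rev h0 h1,
      ev_zigzag hj.le hjA (by omega) (by omega) (by omega),
      ev_zigzag hj.le (by omega) (by omega) (by omega) (by omega)]
    have := zigzag_mem_Icc (N := N) (x := N - x) hj.le (show j < N - A - j by omega) (by omega)
      (by omega) (by omega)
    rw [ev_rev this.1 this.2]
    unfold zigzag
    split_ifs <;> omega

lemma WalkOn.abs_sub_le {g : ℤ → ℤ} {b : ℤ} {a : ℤ} (hg : WalkOn g a b) :
    ∀ x y, a ≤ x → x ≤ y → y ≤ b → g x - g y ≤ y - x ∧ g y - g x ≤ y - x := by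
  intro x y hx hxy
  induction y, hxy using Int.leInduction with
  | base => intro _; simp
  | succ y hy ih =>
    intro hb
    have h1 := ih (by omega)
    have h2 := hg y (by omega) (by omega)
    omega

lemma WalkOn.exists_endo {g : ℤ → ℤ} (hg : WalkOn g 0 N) :
    ∃ (γ : Function.End (Fin (N + 1))) (c : ℤ), IsEndo γ ∧
      ∀ x, 0 ≤ x → x ≤ (N : ℤ) → ev γ x = g x + c := by
  obtain ⟨m, hm, hmin⟩ := Finset.exists_min_image (Finset.Icc (0 : ℤ) N) g ⟨0, by simp⟩
  simp only [Finset.mem_Icc, and_imp] at hm hmin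
  have hev : ∀ x, 0 ≤ x → x ≤ (N : ℤ) → ev (ofInt N fun x => g x - g m) x = g x + -g m := by
    intro x h0 h1
    have h2 := hmin x h0 h1
    have h3 : g x - g m ≤ N := by
      rcases le_total x m with h | h
      · have := hg.abs_sub_le x m h0 h hm.2
        omega
      · have := hg.abs_sub_le m x hm.1 h h1
        omega
    rw [ev_ofInt h0 h1 (by omega) h3]
    omega
  refine ⟨_, _, (isEndo_iff _).2 fun x h0 h1 => ?_, hev⟩
  rw [hev _ (by omega) (by omega), hev _ (by omega) (by omega)]
  have := hg x h0 h1
  omega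

lemma ContainsGens.mem_of_factor (hM : ContainsGens M) (hN : 1 ≤ N)
    {α β : Function.End (Fin (N + 1))} (hβ : β ∈ M) {g : ℤ → ℤ} (hg : WalkOn g 0 N)
    (hfac : ∀ x, 0 ≤ x → x ≤ (N : ℤ) → ev α x = g (ev β x))
    (ih : ∀ γ : Function.End (Fin (N + 1)), IsEndo γ → (turns γ).card < (turns α).card → γ ∈ M)
    {r : ℤ} (hr : r ∈ turns α) (φ : ℤ → ℤ) (hφ : Function.Injective φ)
    (hmaps : ∀ x : ℤ, 0 < x → x < N → g (x - 1) = g (x + 1) → φ x ∈ turns α ∧ φ x ≠ r) :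
    α ∈ M := by
  obtain ⟨γ, c, hγ, hγx⟩ := hg.exists_endo
  have hγM : γ ∈ M := by
    refine ih γ hγ (lt_of_le_of_lt ?_ (Finset.card_erase_lt_of_mem hr))
    refine Finset.card_le_card_of_injOn φ (fun x hx => ?_) hφ.injOn
    obtain ⟨⟨h0, h1⟩, h2⟩ := mem_turns.1 hx
    rw [hγx _ (by omega) (by omega), hγx _ (by omega) (by omega)] at h2
    have := hmaps x h0 h1 (by omega)
    exact Finset.mem_erase.2 ⟨this.2, this.1⟩
  refine hM.mem_of_add hN (-c) (mul_mem hγM hβ) fun x h0 h1 => ?_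
  rw [ev_mul, hγx _ (ev_nonneg _ _) (ev_le _ _), hfac x h0 h1]
  omega

/-- A path endomorphism extends to a walk that goes straight on after its last point. -/
lemma exists_extension (hN : 1 ≤ N) {α : Function.End (Fin (N + 1))} (hα : IsEndo α) :
    ∃ f : ℤ → ℤ, (∀ x : ℤ, x ≤ N → f x = ev α x) ∧ (∀ b, WalkOn f 0 b) ∧
      ∀ x, 0 < x → f (x - 1) = f (x + 1) → x ∈ turns α := by
  have hw := (isEndo_iff α).1 hα
  obtain ⟨d, hd, hd'⟩ : ∃ d : ℤ, ev α N = ev α (N - 1) + d ∧ (d = 1 ∨ d = -1) := by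
    have := hw (N - 1) (by omega) (by omega)
    rw [sub_add_cancel] at this
    exact ⟨ev α N - ev α (N - 1), by omega, by omega⟩
  let f : ℤ → ℤ := fun x => if x ≤ N then ev α x else ev α N + d * (x - N)
  have f1 : ∀ x : ℤ, x ≤ N → f x = ev α x := fun x hx => if_pos hx
  have f2 : ∀ x, (N : ℤ) ≤ x → f x = ev α N + d * (x - N) := by
    intro x hx
    rcases hx.eq_or_lt with h | h
    · rw [f1 x h.ge, ← h]; simp
    · exact if_neg (by omega)
  refine ⟨f, f1, fun b x h0 h1 => ?_, fun x h0 he => ?_⟩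
  · rcases lt_or_ge x N with h | h
    · rw [f1 x h.le, f1 (x + 1) (by omega)]
      exact hw x h0 h
    · rw [f2 x h, f2 (x + 1) (by omega)]
      rcases hd' with rfl | rfl <;> omega
  · rcases lt_trichotomy x N with h | rfl | h
    · rw [f1 (x - 1) (by omega), f1 (x + 1) (by omega)] at he
      exact mem_turns.2 ⟨⟨h0, h⟩, he⟩
    · rw [f1 _ (by omega), f2 _ (by omega)] at he
      rcases hd' with rfl | rfl <;> omega
    · rw [f2 _ (by omega), f2 _ (by omega)] at he
      rcases hd' with rfl | rfl <;> omega

lemma ContainsGens.mem_of_short_start (hM : ContainsGens M) (hN : 1 ≤ N)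
    {α : Function.End (Fin (N + 1))} (hα : IsEndo α)
    (ih : ∀ γ : Function.End (Fin (N + 1)), IsEndo γ → (turns γ).card < (turns α).card → γ ∈ M)
    {r : ℤ} (hr : r ∈ turns α) (hrN : 2 * r ≤ N) (ht : ∀ t ∈ turns α, t = r ∨ 2 * r ≤ t) :
    α ∈ M := by
  obtain ⟨f, hf, hw, hturn⟩ := exists_extension hN hα
  obtain ⟨⟨r0, r1⟩, r2⟩ := mem_turns.1 hr
  have hrefl := WalkOn.reflect (f := f) (r := r) (m := r)
    (fun x h0 h1 => hw (r + r) x (by omega) h1)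
    (by rw [hf _ (by omega), hf _ (by omega), r2])
    (fun x h0 h1 hx he => by have := ht x (hturn x (by omega) he); omega)
  refine hM.mem_of_factor hN (hM.zigzag_mem 0 r le_rfl r0 (by omega)) (g := fun y => f (r + y))
    (fun x h0 h1 => ?_) (fun x h0 h1 => ?_) ih hr (fun y => r + y) (add_right_injective r)
    (fun x h0 h1 he => ?_)
  · change f (r + (x + 1)) = f (r + x) + 1 ∨ f (r + (x + 1)) = f (r + x) - 1
    rw [← add_assoc]
    exact hw (r + x + 1) _ (by omega) (by omega)
  · rw [ev_zigzag le_rfl r0 (by omega) h0 h1, ← hf x h1]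
    simp only [zigzag, if_true]
    split_ifs with h
    · rw [← hrefl (r - x) (by omega) (by omega), sub_sub_cancel]
    · rw [add_sub_cancel]
  · refine ⟨hturn _ (by omega) ?_, by omega⟩
    convert he using 2 <;> ring

lemma ContainsGens.mem_of_short_middle (hM : ContainsGens M) (hN : 1 ≤ N)
    {α : Function.End (Fin (N + 1))} (hα : IsEndo α)
    (ih : ∀ γ : Function.End (Fin (N + 1)), IsEndo γ → (turns γ).card < (turns α).card → γ ∈ M)
    {a j : ℤ} (ha : a ∈ turns α) (hb : a + j ∈ turns α) (hj : 0 < j) (hja : j < a)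
    (hjN : a + 2 * j < N)
    (ht : ∀ t ∈ turns α, t ≤ a - j ∨ t = a ∨ t = a + j ∨ a + 2 * j ≤ t) :
    α ∈ M := by
  obtain ⟨f, hf, hw, hturn⟩ := exists_extension hN hα
  have hrefl : ∀ r ∈ turns α, r = a ∨ r = a + j → ∀ y, 0 ≤ y → y ≤ j → f (r - y) = f (r + y) := by
    intro r hr hr'
    obtain ⟨⟨r0, r1⟩, r2⟩ := mem_turns.1 hr
    refine WalkOn.reflect (f := f) (r := r) (m := j)
      (fun x h0 h1 => hw (r + j) x (by omega) h1)
      (by rw [hf _ (by omega), hf _ (by omega), r2])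
      (fun x h0 h1 hx he => ?_)
    have := ht x (hturn x (by omega) he)
    omega
  have refl_a := hrefl a ha (Or.inl rfl)
  have refl_b := hrefl (a + j) hb (Or.inr rfl)
  let g : ℤ → ℤ := fun y => if y ≤ a then f y else f (y + 2 * j)
  have g1 : ∀ y, y ≤ a → g y = f y := fun y hy => if_pos hy
  have g2 : ∀ y, a ≤ y → g y = f (y + 2 * j) := by
    intro y hy
    rcases hy.eq_or_lt with h | h
    · subst h
      rw [g1 a le_rfl]
      have := refl_b j hj.le le_rfl
      rw [add_sub_cancel_right] at this
      rw [this]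
      congr 1; ring
    · exact if_neg (by omega)
  refine hM.mem_of_factor hN (hM.zigzag_mem' hN hj hja hjN) (g := g)
    (fun x h0 h1 => ?_) (fun x h0 h1 => ?_) ih ha (fun y => if y < a then y else y + 2 * j) ?_
    (fun x h0 h1 he => ?_)
  · rcases lt_or_ge x a with h | h
    · rw [g1 x h.le, g1 (x + 1) (by omega)]
      exact hw (x + 1) x h0 (by omega)
    · rw [g2 x h, g2 (x + 1) (by omega), show x + 1 + 2 * j = x + 2 * j + 1 by ring]
      exact hw (x + 2 * j + 1) _ (by omega) (by omega)
  · rw [ev_zigzag hj.le hja (by omega) h0 h1, ← hf x h1]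
    simp only [zigzag, if_neg hj.ne']
    split_ifs with h h'
    · rw [g1 x h]
    · rw [g1 _ (by omega)]
      have := refl_a (x - a) (by omega) (by omega)
      rw [add_sub_cancel] at this
      rw [← this]
      congr 1; ring
    · rcases le_total (x - 2 * j) a with h2 | h2
      · have e1 := refl_a (a + 2 * j - x) (by omega) (by omega)
        have e2 := refl_b (x - a - j) (by omega) (by omega)
        rw [show a + j - (x - a - j) = a + (a + 2 * j - x) by ring,
          show a + j + (x - a - j) = x by ring] at e2
        rw [g1 _ h2, ← e2, ← e1]
        congr 1; ring
      · rw [g2 _ h2, sub_add_cancel]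
  · intro x y hxy
    dsimp only at hxy
    split_ifs at hxy <;> omega
  · split_ifs with h
    · rw [g1 _ (by omega), g1 _ (by omega)] at he
      exact ⟨hturn x h0 he, by omega⟩
    · refine ⟨hturn _ (by omega) ?_, by omega⟩
      rw [g2 (x + 1) (by omega)] at he
      rcases (not_lt.1 h).eq_or_lt with h | h
      · subst h
        rw [g1 _ (by omega), refl_a 1 (by omega) (by omega)] at he
        have := refl_b (j - 1) (by omega) (by omega)
        rw [show a + j - (j - 1) = a + 1 by ring] at this
        rw [show a + 2 * j - 1 = a + j + (j - 1) by ring, ← this, he]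
        congr 1; ring
      · rw [g2 _ (by omega)] at he
        convert he using 2 <;> ring

lemma card_turns_mul_rev (α : Function.End (Fin (N + 1))) :
    (turns (α * rev N)).card ≤ (turns α).card :=
  Finset.card_le_card_of_injOn (fun x => N - x) (fun _ hx => mem_turns_mul_rev.1 hx)
    sub_right_injective.injOn

lemma ContainsGens.mem_of_isEndo (hM : ContainsGens M) (hN : 1 ≤ N) (k : ℕ) :
    ∀ α : Function.End (Fin (N + 1)), IsEndo α → (turns α).card = k → α ∈ M := by
  induction k using Nat.strong_induction_on with
  | _ k ih =>
  intro α hα hk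
  subst hk
  replace ih : ∀ γ : Function.End (Fin (N + 1)), IsEndo γ →
      (turns γ).card < (turns α).card → γ ∈ M := fun γ hγ h => ih _ h γ hγ rfl
  rcases (turns α).eq_empty_or_nonempty with he | ⟨t, ht⟩
  · rcases eq_one_or_rev hN hα he with rfl | rfl
    · exact one_mem M
    · exact hM.rev_mem
  let V : Finset ℤ := insert 0 (insert (N : ℤ) (turns α))
  have V0 : (0 : ℤ) ∈ V := by simp [V]
  have VN : (N : ℤ) ∈ V := by simp [V]
  have Vt : ∀ t ∈ turns α, t ∈ V := fun t ht => by simp [V, ht]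
  have hmem : ∀ t ∈ turns α, 0 < t ∧ t < N := fun t ht => (mem_turns.1 ht).1
  obtain ⟨⟨a, b⟩, hab, hmin⟩ := Finset.exists_min_image
    ((V ×ˢ V).filter fun p : ℤ × ℤ => p.1 < p.2) (fun p => p.2 - p.1)
    ⟨(0, (N : ℤ)), by simp [V0, VN]; omega⟩
  simp only [Finset.mem_filter, Finset.mem_product, and_imp, Prod.forall] at hab hmin
  obtain ⟨⟨haV, hbV⟩, hab⟩ := hab
  by_cases hstart : ∃ r ∈ turns α, r ≤ b - a
  · obtain ⟨r, hr, hr'⟩ := hstart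
    have := hmem r hr
    refine hM.mem_of_short_start hN hα ih hr ?_ fun t ht => ?_
    · have := hmin r N (Vt r hr) VN (by omega)
      omega
    · have := hmem t ht
      have h1 := hmin 0 t V0 (Vt t ht) (by omega)
      rcases lt_trichotomy t r with h | h | h
      · omega
      · exact Or.inl h
      · have := hmin r t (Vt r hr) (Vt t ht) h
        omega
  by_cases hend : ∃ r ∈ turns α, N - r ≤ b - a
  · obtain ⟨r, hr, hr'⟩ := hend
    have := hmem r hr
    have key : α * rev N ∈ M := by
      refine hM.mem_of_short_start hN (isEndo_mul hα isEndo_rev)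
        (fun γ hγ h => ih γ hγ (h.trans_le (card_turns_mul_rev α))) (r := N - r)
        (mem_turns_mul_rev.2 (by rwa [sub_sub_cancel])) ?_ fun t ht => ?_
      · have := hmin 0 r V0 (Vt r hr) (by omega)
        omega
      · rw [mem_turns_mul_rev] at ht
        have := hmem _ ht
        have h1 := hmin _ N (Vt _ ht) VN (by omega)
        rcases lt_trichotomy (N - t) r with h | h | h
        · have := hmin _ r (Vt _ ht) (Vt r hr) h
          omega
        · left; omega
        · omega
    have := mul_mem key hM.rev_mem
    rwa [mul_assoc, rev_mul_rev, mul_one] at this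
  push Not at hstart hend
  have ht' := hmem t ht
  have hgap : b - a ≤ t := by simpa using hmin 0 t V0 (Vt t ht) (by omega)
  have hbnd : ∀ v ∈ V, 0 ≤ v ∧ v ≤ N := by
    intro v hv
    simp only [V, Finset.mem_insert] at hv
    rcases hv with rfl | rfl | hv
    · omega
    · omega
    · have := hmem v hv; omega
  have ha : a ∈ turns α := by
    simp only [V, Finset.mem_insert] at haV
    rcases haV with h | h | h
    · subst h
      simp only [V, Finset.mem_insert] at hbV
      rcases hbV with h | h | h
      · omega
      · omega
      · have := hstart b h; omega
    · have := hbnd b hbV; omega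
    · exact h
  have hb : b ∈ turns α := by
    simp only [V, Finset.mem_insert] at hbV
    rcases hbV with h | h | h
    · have := hmem a ha; omega
    · have := hend a ha; omega
    · exact h
  have h1 := hstart a ha
  have h2 := hend b hb
  refine hM.mem_of_short_middle hN hα ih (a := a) (j := b - a) ha (by rwa [add_sub_cancel])
    (by omega) h1 (by omega) fun t ht => ?_
  have := hmem t ht
  rcases lt_trichotomy t a with h | h | h
  · have := hmin t a (Vt t ht) haV h
    omega
  · omega
  · have := hmin a t haV (Vt t ht) h
    rcases lt_trichotomy t b with h' | h' | h'
    · omega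
    · omega
    · have := hmin b t hbV (Vt t ht) h'
      omega

/-- The standard generating set of the monoid of path endomorphisms. -/
def gens (N : ℕ) : Set (Function.End (Fin (N + 1))) :=
  insert (rev N)
    (Set.image (fun p : Σ _ : ℕ, ℕ => ofInt N (zigzag p.1 p.2)) (params N : Set (Σ _ : ℕ, ℕ)))

lemma closure_gens (hN : 1 ≤ N) :
    (Submonoid.closure (gens N) : Set (Function.End (Fin (N + 1)))) = {f | IsEndo f} := by
  have hM : ContainsGens (Submonoid.closure (gens N)) := by
    refine ⟨Submonoid.subset_closure (Set.mem_insert _ _), fun j A hj hjA hA => ?_⟩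
    refine Submonoid.subset_closure (Set.mem_insert_of_mem _ ⟨⟨j.toNat, A.toNat⟩, ?_, ?_⟩)
    · rw [Finset.mem_coe, mem_params]
      dsimp only
      omega
    · dsimp only
      rw [Int.toNat_of_nonneg hj, Int.toNat_of_nonneg (by omega)]
  refine Set.Subset.antisymm (fun x hx => ?_) fun x hx => hM.mem_of_isEndo hN _ x hx rfl
  induction hx using Submonoid.closure_induction with
  | mem x hx =>
    rcases hx with rfl | ⟨p, hp, rfl⟩
    · exact isEndo_rev
    · have := mem_params.1 hp
      exact isEndo_zigzag (by omega) (by omega) (by omega)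
  | one => exact isEndo_one
  | mul x y _ _ hx hy => exact isEndo_mul hx hy

lemma ncard_gens_le (N : ℕ) : (gens N).ncard ≤ (params N).card + 1 := by
  refine (Set.ncard_insert_le _ _).trans (Nat.add_le_add_right ?_ 1)
  refine (Set.ncard_image_le (Finset.finite_toSet _)).trans ?_
  rw [Set.ncard_coe_finset]

end PathEnd

/-- The rank of the monoid `End P_n` is `1 + ⌊(n-1)/2⌋ + ∑_{j=1}^{⌊(n-3)/3⌋} ⌊(n-3j-1)/2⌋`:
this number is the least cardinality of a set `S` of transformations generating (as a
monoid) exactly the monoid of all endomorphisms of the path `P_n`. -/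
theorem rank_End_path (n : ℕ) (hn : 2 ≤ n) :
    IsLeast {k : ℕ | ∃ S : Set (Function.End (Fin n)),
        (Submonoid.closure S : Set (Function.End (Fin n))) = {f | IsEndo f} ∧ S.ncard = k}
      (1 + (n - 1) / 2 + ∑ j ∈ Finset.Icc 1 ((n - 3) / 3), (n - 3 * j - 1) / 2) := by
  obtain ⟨N, rfl⟩ : ∃ N, n = N + 1 := ⟨n - 1, by omega⟩
  have hN : 1 ≤ N := by omega
  have hcard : 1 + (N + 1 - 1) / 2 +
      ∑ j ∈ Finset.Icc 1 ((N + 1 - 3) / 3), (N + 1 - 3 * j - 1) / 2 =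
      (PathEnd.params N).card + 1 := by
    rw [PathEnd.card_params, Nat.add_sub_cancel]
    ring
  rw [hcard]
  refine ⟨⟨PathEnd.gens N, PathEnd.closure_gens hN, ?_⟩, ?_⟩
  · exact le_antisymm (PathEnd.ncard_gens_le N) (PathEnd.le_ncard hN (PathEnd.closure_gens hN))
  · rintro k ⟨S, hS, rfl⟩
    exact PathEnd.le_ncard hN hS
end

section
/- Let n ≥ 2. The rank of the monoid wEnd P_n (i.e. the minimum cardinality of a generating set of wEnd P_n) is equal to n + Σ_{j=1}^{⌊(n−3)/3⌋} ⌊(n−3j−1)/2⌋. -/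
namespace WEndPath

/-! ### Lazy walks on the natural numbers -/

/-- Consecutive values of `v` differ by at most one. -/
def IsLazyWalk (v : ℕ → ℕ) : Prop := ∀ x, v (x + 1) ≤ v x + 1 ∧ v x ≤ v (x + 1) + 1

/-- A lazy walk without flat steps and turning points is strictly monotone. -/
theorem IsLazyWalk.monotone_run {v : ℕ → ℕ} (hv : IsLazyWalk v) (a k : ℕ)
    (hs : ∀ x, a ≤ x → x < a + k → v x ≠ v (x + 1))
    (ht : ∀ x, a ≤ x → x + 2 ≤ a + k → v x ≠ v (x + 2)) :
    (∀ t ≤ k, v (a + t) = v a + t) ∨ (∀ t ≤ k, v (a + t) + t = v a) := by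
  induction k with
  | zero =>
    left
    intro t h
    obtain rfl : t = 0 := by omega
    rfl
  | succ k ih =>
    have h := hv (a + k)
    have h' := hs (a + k) (by omega) (by omega)
    rw [add_assoc] at h h'
    have key : k = 0 ∨ v (a + (k - 1)) ≠ v (a + (k + 1)) := by
      rcases Nat.eq_zero_or_pos k with h0 | h0
      · exact Or.inl h0
      · right
        have := ht (a + (k - 1)) (by omega) (by omega)
        rwa [show a + (k - 1) + 2 = a + (k + 1) by omega] at this
    have split : ∀ t, t ≤ k + 1 → t ≤ k ∨ t = k + 1 := by omega
    by_cases hk : k = 0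
    · subst hk
      simp only [zero_add, add_zero] at h h'
      rcases (by omega : v (a + 1) = v a + 1 ∨ v (a + 1) + 1 = v a) with h1 | h1
      · left; intro t ht'
        rcases (by omega : t = 0 ∨ t = 1) with rfl | rfl
        · rfl
        · exact h1
      · right; intro t ht'
        rcases (by omega : t = 0 ∨ t = 1) with rfl | rfl
        · rfl
        · exact h1
    rcases ih (fun x h1 h2 => hs x h1 (by omega)) (fun x h1 h2 => ht x h1 (by omega)) with ih | ih
    · left; intro t ht'
      rcases split t ht' with h1 | rfl
      · exact ih t h1
      · have := ih k le_rfl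
        have := ih (k - 1) (by omega)
        omega
    · right; intro t ht'
      rcases split t ht' with h1 | rfl
      · exact ih t h1
      · have := ih k le_rfl
        have := ih (k - 1) (by omega)
        omega

/-- A lazy walk is symmetric around an isolated turning point. -/
theorem IsLazyWalk.symm_of_turn {v : ℕ → ℕ} (hv : IsLazyWalk v) (a k : ℕ) (hk : k ≤ a)
    (hs : ∀ x, a - k ≤ x → x < a + k → v x ≠ v (x + 1))
    (ht : ∀ x, a - k ≤ x → x + 2 ≤ a + k → v x = v (x + 2) → x + 1 = a)
    (ha : v (a - 1) = v (a + 1)) (t : ℕ) (htk : t ≤ k) : v (a - t) = v (a + t) := by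
  have h1 := hv.monotone_run (a - k) k (fun x _ _ => hs x (by omega) (by omega))
    (fun x _ _ h => by have := ht x (by omega) (by omega) h; omega)
  have h2 := hv.monotone_run a k (fun x _ _ => hs x (by omega) (by omega))
    (fun x _ _ h => by have := ht x (by omega) (by omega) h; omega)
  rcases Nat.eq_zero_or_pos t with rfl | ht0
  · rfl
  have e : ∀ s ≤ k, a - k + (k - s) = a - s := by omega
  have e0 : a - k + k = a := by omega
  rcases h1 with h1 | h1 <;> rcases h2 with h2 | h2 <;>
    · have p1 := h1 k le_rfl
      have p2 := h1 (k - 1) (by omega)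
      have p3 := h1 (k - t) (by omega)
      have p4 := h2 1 (by omega)
      have p5 := h2 t htk
      rw [e0] at p1
      rw [e 1 (by omega)] at p2
      rw [e t htk] at p3
      omega

/-- A strict walk on `{0,…,m}` that turns somewhere is symmetric around a fold, or contains a
zigzag whose middle segment is shorter than both of its neighbours. -/
theorem IsLazyWalk.exists_fold_or_zigzag {v : ℕ → ℕ} (hv : IsLazyWalk v) (m : ℕ)
    (hs : ∀ x < m, v x ≠ v (x + 1)) (c : ℕ) (hc : c + 2 ≤ m) (hcv : v c = v (c + 2)) :
    (∃ a, 0 < a ∧ a < m ∧ ∀ t ≤ a, a + t ≤ m → v (a - t) = v (a + t)) ∨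
    (∃ a j, 0 < j ∧ j < a ∧ a + 2 * j < m ∧ (∀ t ≤ j, v (a - t) = v (a + t)) ∧
      ∀ t ≤ j, v (a + j - t) = v (a + j + t)) := by
  classical
  let T : ℕ → Prop := fun x => x = 0 ∨ x = m ∨ (0 < x ∧ x < m ∧ v (x - 1) = v (x + 1))
  have hT : ∀ x, T x ↔ x = 0 ∨ x = m ∨ (0 < x ∧ x < m ∧ v (x - 1) = v (x + 1)) :=
    fun x => Iff.rfl
  have hTc : T (c + 1) := (hT _).2 (Or.inr (Or.inr ⟨by omega, by omega, hcv⟩))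
  have hex : ∃ j, 0 < j ∧ ∃ a, T a ∧ T (a + j) :=
    ⟨c + 1, by omega, 0, (hT _).2 (Or.inl rfl), by rwa [zero_add]⟩
  obtain ⟨hj0, a, ha, hb⟩ := Nat.find_spec hex
  have hmin : ∀ x y, T x → T y → x < y → Nat.find hex ≤ y - x := fun x y hx hy hxy =>
    Nat.find_min' hex ⟨by omega, x, hx, by rwa [show x + (y - x) = y by omega]⟩
  generalize Nat.find hex = j at *
  have hT0 : T 0 := (hT _).2 (Or.inl rfl)
  have hTm : T m := (hT _).2 (Or.inr (Or.inl rfl))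
  have hj1 := hmin 0 (c + 1) hT0 hTc (by omega)
  have symm : ∀ b, T b → 0 < b → b < m →
      j ≤ b ∧ b + j ≤ m ∧ ∀ t ≤ j, v (b - t) = v (b + t) := by
    intro b hb hb0 hbm
    have q1 := hmin 0 b hT0 hb hb0
    have q2 := hmin b m hb hTm hbm
    refine ⟨by omega, by omega, fun t htj => ?_⟩
    refine hv.symm_of_turn b j (by omega) (fun x _ _ => hs x (by omega)) ?_ ?_ t htj
    · intro x h1 h2 h3
      by_contra hne
      have hx : T (x + 1) := (hT _).2 (Or.inr (Or.inr ⟨by omega, by omega, h3⟩))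
      rcases lt_or_gt_of_ne hne with h | h
      · have := hmin _ _ hx hb h; omega
      · have := hmin _ _ hb hx h; omega
    · rcases (hT b).1 hb with h | h | h
      · omega
      · omega
      · exact h.2.2
  have hbm : a + j ≤ m := by rcases (hT _).1 hb with h | h | h <;> omega
  by_cases ha0 : a = 0
  · left
    subst ha0
    rw [zero_add] at hb
    exact ⟨j, hj0, by omega, fun t h _ => (symm j hb hj0 (by omega)).2.2 t h⟩
  by_cases hbm' : a + j = m
  · left
    exact ⟨a, by omega, by omega, fun t h _ =>
      (symm a ha (by omega) (by omega)).2.2 t (by omega)⟩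
  obtain ⟨q1, q2, q3⟩ := symm a ha (by omega) (by omega)
  obtain ⟨r1, r2, r3⟩ := symm (a + j) hb (by omega) (by omega)
  by_cases hja : j = a
  · left
    exact ⟨a, by omega, by omega, fun t h _ => q3 t (by omega)⟩
  by_cases hjm : a + j + j = m
  · left
    exact ⟨a + j, by omega, by omega, fun t h _ => r3 t (by omega)⟩
  exact Or.inr ⟨a, j, hj0, by omega, by omega, q3, r3⟩

/-! ### Transformations of `Fin (N + 1)` as functions on the natural numbers -/

variable {N : ℕ}

/-- The transformation `f` as a function on `ℕ`, constant from `N` on. -/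
def val (f : Function.End (Fin (N + 1))) (x : ℕ) : ℕ := (f ⟨min x N, by omega⟩ : Fin (N + 1))

/-- The transformation of `Fin (N + 1)` given by a function on `ℕ`, truncated at `N`. -/
def ofVal (N : ℕ) (F : ℕ → ℕ) : Function.End (Fin (N + 1)) := fun x => ⟨min (F x) N, by omega⟩

theorem val_le (f : Function.End (Fin (N + 1))) (x : ℕ) : val f x ≤ N :=
  Nat.lt_succ_iff.1 (f _).2

theorem val_ofVal (F : ℕ → ℕ) (x : ℕ) : val (ofVal N F) x = min (F (min x N)) N := rfl

theorem val_one (x : ℕ) : val (1 : Function.End (Fin (N + 1))) x = min x N := rfl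

theorem val_mul (f g : Function.End (Fin (N + 1))) (x : ℕ) :
    val (f * g) x = val f (val g x) := by
  have h := val_le g x
  unfold val at h ⊢
  simp only [min_eq_left h]
  rfl

theorem ext_val {f g : Function.End (Fin (N + 1))} (h : ∀ x ≤ N, val f x = val g x) : f = g := by
  funext x
  have hx : (x : ℕ) ≤ N := Nat.lt_succ_iff.1 x.2
  have := h x hx
  simp only [val, min_eq_left hx] at this
  exact Fin.ext this

theorem isWEndo_iff (f : Function.End (Fin (N + 1))) : IsWEndo f ↔ IsLazyWalk (val f) := by
  constructor
  · intro h x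
    rcases lt_or_ge x N with hx | hx
    · have := h x (by omega)
      rw [abs_le] at this
      simp only [val, min_eq_left hx.le, min_eq_left (show x + 1 ≤ N from hx)]
      omega
    · simp only [val, min_eq_right hx, min_eq_right (show N ≤ x + 1 by omega)]
      omega
  · intro h x hx
    have := h x
    simp only [val, min_eq_left (show x ≤ N by omega),
      min_eq_left (show x + 1 ≤ N by omega)] at this
    rw [abs_le]
    omega

theorem isWEndo_ofVal {F : ℕ → ℕ} (h : IsLazyWalk F) : IsWEndo (ofVal N F) := by
  rw [isWEndo_iff]
  intro x
  simp only [val_ofVal]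
  rcases lt_or_ge x N with hx | hx
  · have := h x
    rw [min_eq_left hx.le, min_eq_left (show x + 1 ≤ N from hx)]
    omega
  · rw [min_eq_right hx, min_eq_right (show N ≤ x + 1 by omega)]
    omega

theorem isWEndo_one : IsWEndo (1 : Function.End (Fin (N + 1))) := by
  rw [isWEndo_iff]
  intro x
  simp only [val_one]
  omega

theorem isWEndo_mul {f g : Function.End (Fin (N + 1))} (hf : IsWEndo f) (hg : IsWEndo g) :
    IsWEndo (f * g) := by
  rw [isWEndo_iff] at *
  intro x
  simp only [val_mul]
  have h := hg x
  rcases (by omega : val g (x + 1) = val g x ∨ val g (x + 1) = val g x + 1 ∨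
    val g x = val g (x + 1) + 1) with h | h | h
  · rw [h]; omega
  · rw [h]; exact hf _
  · rw [h]; exact (hf _).symm

/-! ### The generators -/

/-- The reflection of the path. -/
def refl (N : ℕ) : Function.End (Fin (N + 1)) := ofVal N fun x => N - x

/-- The map collapsing the edge `{i, i + 1}`. -/
def flat (N i : ℕ) : Function.End (Fin (N + 1)) := ofVal N fun x => if x ≤ i then x else x - 1

/-- The map folding the path at the vertex `a`. -/
def fold (N a : ℕ) : Function.End (Fin (N + 1)) := ofVal N fun x => (x - a) + (a - x)

/-- The map turning at the vertices `a` and `a + j`. -/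
def zigzag (N a j : ℕ) : Function.End (Fin (N + 1)) :=
  ofVal N fun x => if x ≤ a then x else if x ≤ a + j then 2 * a - x else x - 2 * j

theorem val_refl (x : ℕ) : val (refl N) x = N - x := by
  rw [refl, val_ofVal]; omega

theorem val_flat (i x : ℕ) (hx : x ≤ N) :
    val (flat N i) x = if x ≤ i then x else x - 1 := by
  rw [flat, val_ofVal, min_eq_left hx]; split_ifs <;> omega

theorem val_fold (a x : ℕ) (ha : a ≤ N) (hx : x ≤ N) :
    val (fold N a) x = (x - a) + (a - x) := by
  rw [fold, val_ofVal, min_eq_left hx]; omega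

theorem val_zigzag (a j x : ℕ) (ha : a ≤ N) (hx : x ≤ N) : val (zigzag N a j) x =
    if x ≤ a then x else if x ≤ a + j then 2 * a - x else x - 2 * j := by
  rw [zigzag, val_ofVal, min_eq_left hx]; split_ifs <;> omega

/-- The index type of the generators. -/
abbrev Index : Type := Unit ⊕ ℕ ⊕ ℕ ⊕ (_ : ℕ) × ℕ

/-- The generator with a given index; the index `⟨j, k⟩` stands for the zigzag with segments of
lengths `j + 1 + k`, `j` and the rest. -/
def gen (N : ℕ) : Index → Function.End (Fin (N + 1))
  | .inl _ => refl N
  | .inr (.inl i) => flat N i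
  | .inr (.inr (.inl a)) => fold N a
  | .inr (.inr (.inr p)) => zigzag N (p.1 + 1 + p.2) p.1

/-- The finite set of indices of the generators. -/
def indices (N : ℕ) : Finset Index :=
  Finset.univ.disjSum <| (Finset.range ((N + 1) / 2)).disjSum <| (Finset.Icc 1 (N / 2)).disjSum <|
    (Finset.Icc 1 ((N - 2) / 3)).sigma fun j => Finset.range ((N - 3 * j) / 2)

theorem card_indices (N : ℕ) : (indices N).card =
    N + 1 + ∑ j ∈ Finset.Icc 1 ((N - 2) / 3), (N - 3 * j) / 2 := by
  simp only [indices, Finset.card_disjSum, Finset.card_sigma, Finset.card_range, Nat.card_Icc,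
    Finset.card_univ, Fintype.card_unit]
  omega

theorem isWEndo_gen (κ : Index) : IsWEndo (gen N κ) := by
  rcases κ with _ | i | a | ⟨j, k⟩
  · exact isWEndo_ofVal fun x => by omega
  · exact isWEndo_ofVal fun x => by split_ifs <;> omega
  · exact isWEndo_ofVal fun x => by omega
  · exact isWEndo_ofVal fun x => by split_ifs <;> omega

/-! ### The generators generate -/

section Generation

variable {M : Submonoid (Function.End (Fin (N + 1)))} (hM : ∀ κ ∈ indices N, gen N κ ∈ M)

include hM

theorem refl_mem : refl N ∈ M := hM (.inl ()) (by simp [indices])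

theorem shiftDown_mem (hN : 1 ≤ N) : flat N 0 ∈ M :=
  hM (.inr (.inl 0)) (by simp [indices]; omega)

theorem exists_shiftUp_mem (hN : 1 ≤ N) (s : ℕ) :
    ∃ p ∈ M, ∀ x ≤ N, val p x = min (x + s) N := by
  induction s with
  | zero => exact ⟨1, M.one_mem, fun x _ => val_one x⟩
  | succ s ih =>
    obtain ⟨p, hp, h⟩ := ih
    refine ⟨refl N * flat N 0 * refl N * p,
      M.mul_mem (M.mul_mem (M.mul_mem (refl_mem hM) (shiftDown_mem hM hN)) (refl_mem hM)) hp,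
      fun x hx => ?_⟩
    rw [val_mul, h x hx, val_mul, val_mul, val_refl (min _ _), val_flat _ _ (by omega), val_refl]
    split_ifs <;> omega

theorem exists_shiftDown_mem (hN : 1 ≤ N) (s : ℕ) :
    ∃ p ∈ M, ∀ x ≤ N, val p x = x - s := by
  obtain ⟨p, hp, h⟩ := exists_shiftUp_mem hM hN s
  refine ⟨refl N * p * refl N, M.mul_mem (M.mul_mem (refl_mem hM) hp) (refl_mem hM),
    fun x hx => ?_⟩
  rw [val_mul, val_mul, val_refl, val_refl, h _ (by omega)]
  omega

theorem flat_mem {i : ℕ} (hi : i < N) : flat N i ∈ M := by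
  by_cases h : i < (N + 1) / 2
  · exact hM (.inr (.inl i)) (by simpa [indices] using h)
  · have h1 : flat N (N - 1 - i) ∈ M :=
      hM (.inr (.inl (N - 1 - i))) (by simp [indices]; omega)
    have : flat N i = flat N 0 * (refl N * flat N (N - 1 - i) * refl N) := by
      refine ext_val fun x hx => ?_
      rw [val_mul, val_mul, val_mul, val_flat _ _ hx, val_refl, val_flat _ _ (by omega), val_refl,
        val_flat _ _ (by omega)]
      split_ifs <;> omega
    rw [this]
    exact M.mul_mem (shiftDown_mem hM (by omega))
      (M.mul_mem (M.mul_mem (refl_mem hM) h1) (refl_mem hM))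

theorem fold_mem {a : ℕ} (h0 : 0 < a) (ha : a < N) : fold N a ∈ M := by
  by_cases h : a ≤ N / 2
  · exact hM (.inr (.inr (.inl a))) (by simp [indices]; omega)
  · have h1 : fold N (N - a) ∈ M :=
      hM (.inr (.inr (.inl (N - a)))) (by simp [indices]; omega)
    have : fold N a = fold N (N - a) * refl N := by
      refine ext_val fun x hx => ?_
      rw [val_mul, val_fold _ _ ha.le hx, val_refl, val_fold _ _ (by omega) (by omega)]
      omega
    rw [this]
    exact M.mul_mem h1 (refl_mem hM)

theorem zigzag_mem {a j : ℕ} (h0 : 0 < j) (hj : j < a) (ha : a + 2 * j < N) :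
    zigzag N a j ∈ M := by
  have key : ∀ b, j < b → 2 * b + j ≤ N → zigzag N b j ∈ M := by
    intro b h1 h2
    have h3 := hM (.inr (.inr (.inr ⟨j, b - j - 1⟩))) (by simp [indices]; omega)
    simpa only [gen, show j + 1 + (b - j - 1) = b by omega] using h3
  by_cases h : 2 * a + j ≤ N
  · exact key a hj h
  · obtain ⟨p, hp, hpv⟩ := exists_shiftDown_mem hM (show 1 ≤ N by omega) (2 * j)
    have : zigzag N a j = p * (refl N * zigzag N (N - a - j) j * refl N) := by
      refine ext_val fun x hx => ?_
      rw [val_mul, val_mul, val_mul, val_zigzag _ _ _ (by omega) hx, val_refl x,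
        val_zigzag _ _ _ (by omega) (by omega), val_refl, hpv _ (by omega)]
      split_ifs <;> omega
    rw [this]
    exact M.mul_mem hp (M.mul_mem (M.mul_mem (refl_mem hM) (key _ (by omega) (by omega)))
      (refl_mem hM))

/-- Every weak endomorphism agrees with a product of generators on `{0,…,m}`. -/
theorem exists_mem_eqOn (hN : 1 ≤ N) (m : ℕ) : m ≤ N → ∀ f : Function.End (Fin (N + 1)),
    IsWEndo f → ∃ p ∈ M, ∀ x ≤ m, val p x = val f x := by
  induction m using Nat.strong_induction_on with
  | _ m ih =>
    intro hm f hf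
    have hv := (isWEndo_iff f).1 hf
    have factor : ∀ (q : Function.End (Fin (N + 1))) (F : ℕ → ℕ) (m' : ℕ), q ∈ M →
        IsLazyWalk F → m' < m → (∀ x ≤ m, val q x ≤ m' ∧ F (val q x) = val f x) →
        ∃ p ∈ M, ∀ x ≤ m, val p x = val f x := by
      intro q F m' hq hF hm' h
      obtain ⟨p, hp, hpF⟩ := ih m' hm' (by omega) (ofVal N F) (isWEndo_ofVal hF)
      refine ⟨p * q, M.mul_mem hp hq, fun x hx => ?_⟩
      obtain ⟨h1, h2⟩ := h x hx
      rw [val_mul, hpF _ h1, val_ofVal, min_eq_left (show val q x ≤ N by omega), h2,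
        min_eq_left (val_le f x)]
    by_cases hs : ∀ x < m, val f x ≠ val f (x + 1)
    swap
    · push Not at hs
      obtain ⟨i, him, hi⟩ := hs
      refine factor (flat N i) (fun y => val f (if y ≤ i then y else y + 1)) (m - 1)
        (flat_mem hM (by omega)) (fun y => ?_) (by omega) fun x hx => ?_
      · dsimp only
        rcases lt_trichotomy y i with h | h | h
        · rw [if_pos h.le, if_pos (by omega)]; exact hv y
        · subst h
          rw [if_pos le_rfl, if_neg (by omega), hi]; exact hv _
        · rw [if_neg (by omega), if_neg (by omega)]; exact hv _
      · rw [val_flat _ _ (by omega)]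
        rcases lt_trichotomy x (i + 1) with h | h | h
        · rw [if_pos (by omega), if_pos (by omega)]; exact ⟨by omega, rfl⟩
        · subst h
          rw [if_neg (by omega), if_pos (by omega)]; exact ⟨by omega, hi⟩
        · rw [if_neg (by omega), if_neg (by omega)]
          exact ⟨by omega, by rw [show x - 1 + 1 = x by omega]⟩
    by_cases ht : ∀ c, c + 2 ≤ m → val f c ≠ val f (c + 2)
    · have h := hv.monotone_run 0 m (fun x _ _ => hs x (by omega)) (fun x _ _ => ht x (by omega))
      simp only [zero_add] at h
      rcases h with h | h
      · obtain ⟨p, hp, hpv⟩ := exists_shiftUp_mem hM hN (val f 0)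
        refine ⟨p, hp, fun x hx => ?_⟩
        have := val_le f x
        rw [hpv x (by omega), h x hx]
        have := h x hx
        omega
      · obtain ⟨p, hp, hpv⟩ := exists_shiftUp_mem hM hN (N - val f 0)
        refine ⟨refl N * p, M.mul_mem (refl_mem hM) hp, fun x hx => ?_⟩
        have := val_le f 0
        have := h x hx
        rw [val_mul, val_refl, hpv x (by omega)]
        omega
    push Not at ht
    obtain ⟨c, hc, hcv⟩ := ht
    rcases hv.exists_fold_or_zigzag m hs c hc hcv with
      ⟨a, ha0, ham, h⟩ | ⟨a, j, hj, hja, hm', h1, h2⟩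
    · by_cases hlong : a ≤ m - a
      · refine factor (fold N a) (fun y => val f (a + y)) (m - a)
          (fold_mem hM ha0 (by omega)) (fun y => hv (a + y)) (by omega) fun x hx => ?_
        rw [val_fold _ _ (by omega) (by omega)]
        refine ⟨by omega, ?_⟩
        rcases le_total x a with hxa | hxa
        · have := h (a - x) (by omega) (by omega)
          rw [show a - (a - x) = x by omega] at this
          rw [this]; congr 1; omega
        · congr 1; omega
      · refine factor (fold N a) (fun y => val f (a - y)) a
          (fold_mem hM ha0 (by omega)) (fun y => ?_) (by omega) fun x hx => ?_
        · dsimp only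
          rcases lt_or_ge y a with hy | hy
          · have := hv (a - (y + 1))
            rw [show a - (y + 1) + 1 = a - y by omega] at this
            exact this.symm
          · rw [show a - (y + 1) = a - y by omega]; omega
        · rw [val_fold _ _ (by omega) (by omega)]
          refine ⟨by omega, ?_⟩
          rcases le_total x a with hxa | hxa
          · congr 1; omega
          · have := h (x - a) (by omega) (by omega)
            rw [show a + (x - a) = x by omega] at this
            rw [← this]; congr 1; omega
    · have hloop : val f a = val f (a + 2 * j) := by
        have := h2 j le_rfl
        rwa [show a + j - j = a by omega, show a + j + j = a + 2 * j by omega] at this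
      refine factor (zigzag N a j) (fun y => val f (if y ≤ a then y else y + 2 * j)) (m - 2 * j)
        (zigzag_mem hM hj hja (by omega)) (fun y => ?_) (by omega) fun x hx => ?_
      · dsimp only
        rcases lt_trichotomy y a with h | h | h
        · rw [if_pos h.le, if_pos (by omega)]; exact hv y
        · subst h
          rw [if_pos le_rfl, if_neg (by omega), hloop, show y + 1 + 2 * j = y + 2 * j + 1 by omega]
          exact hv _
        · rw [if_neg (by omega), if_neg (by omega), show y + 1 + 2 * j = y + 2 * j + 1 by omega]
          exact hv _
      · rw [val_zigzag _ _ _ (by omega) (by omega)]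
        by_cases hxa : x ≤ a
        · rw [if_pos hxa, if_pos hxa]; exact ⟨by omega, rfl⟩
        by_cases hxb : x ≤ a + j
        · rw [if_neg hxa, if_pos hxb, if_pos (by omega)]
          refine ⟨by omega, ?_⟩
          have := h1 (x - a) (by omega)
          rw [show a + (x - a) = x by omega] at this
          rw [← this]; congr 1; omega
        · rw [if_neg hxa, if_neg hxb]
          refine ⟨by omega, ?_⟩
          by_cases hx2 : x - 2 * j ≤ a
          · rw [if_pos hx2]
            have e1 := h2 (x - (a + j)) (by omega)
            have e2 := h1 (a + 2 * j - x) (by omega)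
            rw [show a + j + (x - (a + j)) = x by omega] at e1
            rw [← e1, show a + j - (x - (a + j)) = a + (a + 2 * j - x) by omega, ← e2]
            congr 1; omega
          · rw [if_neg hx2]; congr 1; omega

end Generation

theorem closure_gen (hN : 1 ≤ N) :
    (Submonoid.closure (gen N '' indices N) : Set (Function.End (Fin (N + 1)))) =
      {f | IsWEndo f} := by
  let W : Submonoid (Function.End (Fin (N + 1))) :=
    { carrier := {f | IsWEndo f}
      one_mem' := isWEndo_one
      mul_mem' := isWEndo_mul }
  apply Set.Subset.antisymm
  · change Submonoid.closure (gen N '' indices N) ≤ W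
    rw [Submonoid.closure_le]
    rintro _ ⟨κ, -, rfl⟩
    exact isWEndo_gen κ
  · intro f hf
    obtain ⟨p, hp, h⟩ := exists_mem_eqOn
      (M := Submonoid.closure (gen N '' (indices N : Set Index)))
      (fun κ hκ => Submonoid.subset_closure (Set.mem_image_of_mem _ hκ)) hN N le_rfl f hf
    rw [← ext_val h]
    exact hp

/-! ### Every generating set meets the type of every generator -/

/-- The edges collapsed by `f`. -/
def flats (f : Function.End (Fin (N + 1))) : Set ℕ := {x | x + 1 ≤ N ∧ val f x = val f (x + 1)}

/-- The predecessors of the vertices at which `f` turns (or is constant). -/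
def turns (f : Function.End (Fin (N + 1))) : Set ℕ := {x | x + 2 ≤ N ∧ val f x = val f (x + 2)}

theorem mem_flats {f : Function.End (Fin (N + 1))} {x : ℕ} :
    x ∈ flats f ↔ x + 1 ≤ N ∧ val f x = val f (x + 1) := Iff.rfl

theorem mem_turns {f : Function.End (Fin (N + 1))} {x : ℕ} :
    x ∈ turns f ↔ x + 2 ≤ N ∧ val f x = val f (x + 2) := Iff.rfl

/-- The automorphisms of the path. -/
def IsAut (f : Function.End (Fin (N + 1))) : Prop := f = 1 ∨ f = refl N

theorem refl_mul_refl : refl N * refl N = 1 :=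
  ext_val fun x hx => by rw [val_mul, val_refl, val_refl, val_one]; omega

theorem IsAut.mul {f g : Function.End (Fin (N + 1))} (hf : IsAut f) (hg : IsAut g) :
    IsAut (f * g) := by
  rcases hf with rfl | rfl <;> rcases hg with rfl | rfl
  · left; exact one_mul _
  · right; exact one_mul _
  · right; exact mul_one _
  · left; exact refl_mul_refl

theorem isAut_of_flats_turns {f : Function.End (Fin (N + 1))} (hf : IsWEndo f)
    (h1 : flats f = ∅) (h2 : turns f = ∅) : IsAut f := by
  have hv := (isWEndo_iff f).1 hf
  have h := hv.monotone_run 0 N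
    (fun x _ hx he => Set.eq_empty_iff_forall_notMem.1 h1 x ⟨by omega, he⟩)
    (fun x _ hx he => Set.eq_empty_iff_forall_notMem.1 h2 x ⟨by omega, he⟩)
  simp only [zero_add] at h
  have := val_le f 0
  have := val_le f N
  rcases h with h | h
  · left
    refine ext_val fun x hx => ?_
    have := h N le_rfl
    have := h x hx
    rw [val_one]; omega
  · right
    refine ext_val fun x hx => ?_
    have := h N le_rfl
    have := h x hx
    rw [val_refl]; omega

theorem flats_subset (h w : Function.End (Fin (N + 1))) : flats w ⊆ flats (h * w) :=
  fun x hx => ⟨hx.1, by rw [val_mul, val_mul, hx.2]⟩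

theorem turns_subset (h w : Function.End (Fin (N + 1))) : turns w ⊆ turns (h * w) :=
  fun x hx => ⟨hx.1, by rw [val_mul, val_mul, hx.2]⟩

theorem mem_flats_mul_refl (s : Function.End (Fin (N + 1))) (x : ℕ) :
    x ∈ flats (s * refl N) ↔ x + 1 ≤ N ∧ N - 1 - x ∈ flats s := by
  rw [mem_flats, mem_flats, val_mul, val_mul, val_refl, val_refl]
  constructor
  · rintro ⟨h1, h2⟩
    refine ⟨h1, by omega, ?_⟩
    rw [show N - 1 - x = N - (x + 1) by omega, show N - (x + 1) + 1 = N - x by omega, h2]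
  · rintro ⟨h1, -, h2⟩
    rw [show N - 1 - x = N - (x + 1) by omega, show N - (x + 1) + 1 = N - x by omega] at h2
    exact ⟨h1, h2.symm⟩

theorem mem_turns_mul_refl (s : Function.End (Fin (N + 1))) (x : ℕ) :
    x ∈ turns (s * refl N) ↔ x + 2 ≤ N ∧ N - 2 - x ∈ turns s := by
  rw [mem_turns, mem_turns, val_mul, val_mul, val_refl, val_refl]
  constructor
  · rintro ⟨h1, h2⟩
    refine ⟨h1, by omega, ?_⟩
    rw [show N - 2 - x = N - (x + 2) by omega, show N - (x + 2) + 2 = N - x by omega, h2]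
  · rintro ⟨h1, -, h2⟩
    rw [show N - 2 - x = N - (x + 2) by omega, show N - (x + 2) + 2 = N - x by omega] at h2
    exact ⟨h1, h2.symm⟩

/-- The edges collapsed by the generator with a given index. -/
def indexFlats : Index → Set ℕ
  | .inr (.inl i) => {i}
  | _ => ∅

/-- The predecessors of the vertices at which the generator with a given index turns. -/
def indexTurns : Index → Set ℕ
  | .inr (.inr (.inl a)) => {a - 1}
  | .inr (.inr (.inr p)) => {p.1 + p.2, 2 * p.1 + p.2}
  | _ => ∅

theorem flats_gen_subset {κ : Index} (hκ : κ ∈ indices N) : flats (gen N κ) ⊆ indexFlats κ := by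
  rintro x ⟨hx, h⟩
  rcases κ with _ | i | a | ⟨j, k⟩ <;> simp [indices] at hκ <;>
    simp only [gen, indexFlats, Set.mem_singleton_iff, Set.mem_empty_iff_false] at h ⊢
  · rw [val_refl, val_refl] at h; omega
  · rw [val_flat _ _ (by omega), val_flat _ _ hx] at h; split_ifs at h <;> omega
  · rw [val_fold _ _ (by omega) (by omega), val_fold _ _ (by omega) hx] at h; omega
  · rw [val_zigzag _ _ _ (by omega) (by omega), val_zigzag _ _ _ (by omega) hx] at h
    split_ifs at h <;> omega

theorem turns_gen_subset {κ : Index} (hκ : κ ∈ indices N) : turns (gen N κ) ⊆ indexTurns κ := by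
  rintro x ⟨hx, h⟩
  rcases κ with _ | i | a | ⟨j, k⟩ <;> simp [indices] at hκ <;>
    simp only [gen, indexTurns, Set.mem_singleton_iff, Set.mem_insert_iff,
      Set.mem_empty_iff_false] at h ⊢
  · rw [val_refl, val_refl] at h; omega
  · rw [val_flat _ _ (by omega), val_flat _ _ hx] at h; split_ifs at h <;> omega
  · rw [val_fold _ _ (by omega) (by omega), val_fold _ _ (by omega) hx] at h; omega
  · rw [val_zigzag _ _ _ (by omega) (by omega), val_zigzag _ _ _ (by omega) hx] at h
    split_ifs at h <;> omega

/-- A right factor of a generator that is not an automorphism collapses and turns exactly where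
the generator does. -/
theorem flats_turns_of_gen_eq_mul {κ : Index} (hκ : κ ∈ indices N) (h₀ : κ ≠ .inl ())
    {h w : Function.End (Fin (N + 1))} (hw : IsWEndo w) (haut : ¬ IsAut w)
    (hgen : gen N κ = h * w) : flats w = indexFlats κ ∧ turns w = indexTurns κ := by
  have hF : flats w ⊆ indexFlats κ := by
    refine (flats_subset h w).trans ?_
    rw [← hgen]
    exact flats_gen_subset hκ
  have hT : turns w ⊆ indexTurns κ := by
    refine (turns_subset h w).trans ?_
    rw [← hgen]
    exact turns_gen_subset hκ
  have hne : flats w = ∅ → turns w ≠ ∅ := fun h1 h2 => haut (isAut_of_flats_turns hw h1 h2)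
  rcases κ with u | i | a | ⟨j, k⟩
  · exact absurd rfl h₀
  · have h2 : turns w = ∅ := Set.subset_empty_iff.1 hT
    refine ⟨(Set.subset_singleton_iff_eq.1 hF).resolve_left fun h1 => hne h1 h2, h2⟩
  · have h1 : flats w = ∅ := Set.subset_empty_iff.1 hF
    exact ⟨h1, (Set.subset_singleton_iff_eq.1 hT).resolve_left (hne h1)⟩
  · have h1 : flats w = ∅ := Set.subset_empty_iff.1 hF
    refine ⟨h1, hT.antisymm ?_⟩
    simp [indices] at hκ
    simp only [indexTurns] at hT ⊢
    have hv := (isWEndo_iff w).1 hw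
    have strict : ∀ x, x + 1 ≤ N → val w x ≠ val w (x + 1) :=
      fun x hx he => Set.eq_empty_iff_forall_notMem.1 h1 x ⟨hx, he⟩
    have hval : ∀ x y, val w x = val w y → val (gen N (.inr (.inr (.inr ⟨j, k⟩)))) x =
        val (gen N (.inr (.inr (.inr ⟨j, k⟩)))) y := by
      intro x y hxy
      rw [hgen, val_mul, val_mul, hxy]
    have isolated : ∀ c, j ≤ c → c + j + 2 ≤ N → c ∈ turns w → turns w ⊆ {c} →
        val w (c - j) = val w (c + j + 2) := by
      intro c hc1 hc2 hc hcT
      have := hv.symm_of_turn (c + 1) (j + 1) (by omega) (fun x _ hx => strict x (by omega))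
        (fun x _ hx he => by have : x = c := hcT ⟨by omega, he⟩
                             omega)
        hc.2 (j + 1) le_rfl
      rwa [show c + 1 - (j + 1) = c - j by omega,
        show c + 1 + (j + 1) = c + j + 2 by omega] at this
    obtain ⟨c, hc⟩ := Set.nonempty_iff_ne_empty.2 (hne h1)
    have both : j + k ∈ turns w ∧ 2 * j + k ∈ turns w := by
      by_contra hcon
      rcases hT hc with rfl | hc'
      · have h2 : 2 * j + k ∉ turns w := fun h3 => hcon ⟨hc, h3⟩
        have := hval _ _ (isolated (j + k) (by omega) (by omega) hc fun x hx => by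
          rcases hT hx with h | h
          · exact h
          · rw [Set.mem_singleton_iff] at h; exact absurd (h ▸ hx) h2)
        simp only [gen] at this
        rw [val_zigzag _ _ _ (by omega) (by omega), val_zigzag _ _ _ (by omega) (by omega)] at this
        split_ifs at this <;> omega
      · rw [Set.mem_singleton_iff] at hc'
        subst hc'
        have h2 : j + k ∉ turns w := fun h3 => hcon ⟨h3, hc⟩
        have := hval _ _ (isolated (2 * j + k) (by omega) (by omega) hc fun x hx => by
          rcases hT hx with h | h
          · exact absurd (h ▸ hx) h2
          · exact h)
        simp only [gen] at this
        rw [val_zigzag _ _ _ (by omega) (by omega), val_zigzag _ _ _ (by omega) (by omega)] at this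
        split_ifs at this <;> omega
    rintro x (rfl | rfl)
    · exact both.1
    · exact both.2

/-- A product of elements of `S` is an automorphism, or factors through an element of `S` that is
not an automorphism and is preceded by an automorphism only. -/
theorem exists_factor {S : Set (Function.End (Fin (N + 1)))} {f : Function.End (Fin (N + 1))}
    (hf : f ∈ Submonoid.closure S) :
    IsAut f ∨ ∃ s ∈ S, ∃ u h, IsAut u ∧ ¬ IsAut (s * u) ∧ f = h * (s * u) := by
  induction hf using Submonoid.closure_induction with
  | mem s hs =>
    by_cases h : IsAut s
    · exact Or.inl h
    · exact Or.inr ⟨s, hs, 1, 1, Or.inl rfl, by rwa [mul_one], by rw [mul_one, one_mul]⟩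
  | one => exact Or.inl (Or.inl rfl)
  | mul f g _ _ ihf ihg =>
    rcases ihg with hg | ⟨s, hs, u, h, hu, hsu, rfl⟩
    · rcases ihf with hf | ⟨s, hs, u, h, hu, hsu, rfl⟩
      · exact Or.inl (hf.mul hg)
      · refine Or.inr ⟨s, hs, u * g, h, hu.mul hg, fun hcon => hsu ?_, by simp only [mul_assoc]⟩
        have hgg : g * g = 1 := by
          rcases hg with rfl | rfl
          · exact one_mul _
          · exact refl_mul_refl
        have := hcon.mul hg
        rwa [mul_assoc, mul_assoc, hgg, mul_one] at this
    · exact Or.inr ⟨s, hs, u, f * h, hu, hsu, by simp only [mul_assoc]⟩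

theorem IsAut.eq_of_val_eq {f : Function.End (Fin (N + 1))} (h : IsAut f) {x y : ℕ} (hx : x ≤ N)
    (hy : y ≤ N) (he : val f x = val f y) : x = y := by
  rcases h with rfl | rfl
  · rw [val_one, val_one] at he; omega
  · rw [val_refl, val_refl] at he; omega

theorem not_isAut_gen {κ : Index} (hκ : κ ∈ indices N) (h₀ : κ ≠ .inl ()) :
    ¬ IsAut (gen N κ) := by
  intro h
  rcases κ with _ | i | a | ⟨j, k⟩
  · exact h₀ rfl
  all_goals simp [indices] at hκ
  · have := h.eq_of_val_eq (x := i) (y := i + 1) (by omega) (by omega) (by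
      rw [gen, val_flat _ _ (by omega), val_flat _ _ (by omega)]; split_ifs <;> omega)
    omega
  · have := h.eq_of_val_eq (x := a - 1) (y := a + 1) (by omega) (by omega) (by
      rw [gen, val_fold _ _ (by omega) (by omega), val_fold _ _ (by omega) (by omega)]; omega)
    omega
  · have := h.eq_of_val_eq (x := j + k) (y := j + k + 2) (by omega) (by omega) (by
      simp only [gen]
      rw [val_zigzag _ _ _ (by omega) (by omega), val_zigzag _ _ _ (by omega) (by omega)]
      split_ifs <;> omega)
    omega

theorem isAut_of_mul_right {f g : Function.End (Fin (N + 1))} (hg : IsWEndo g)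
    (h : IsAut (f * g)) : IsAut g := by
  have hinj : ∀ x y, x ≤ N → y ≤ N → val g x = val g y → x = y := fun x y hx hy hxy =>
    h.eq_of_val_eq hx hy (by rw [val_mul, val_mul, hxy])
  refine isAut_of_flats_turns hg ?_ ?_
  · refine Set.eq_empty_iff_forall_notMem.2 fun x hx => ?_
    have := hinj _ _ (by have := hx.1; omega) hx.1 hx.2
    omega
  · refine Set.eq_empty_iff_forall_notMem.2 fun x hx => ?_
    have := hinj _ _ (by have := hx.1; omega) hx.1 hx.2
    omega

theorem refl_ne_one (hN : 1 ≤ N) : refl N ≠ 1 := fun h => by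
  have := congrArg (fun f => val f 0) h
  simp only [val_refl, val_one] at this
  omega

theorem refl_mem_of_closure (hN : 1 ≤ N) {S : Set (Function.End (Fin (N + 1)))}
    (hS : (Submonoid.closure S : Set (Function.End (Fin (N + 1)))) = {f | IsWEndo f}) :
    refl N ∈ S := by
  by_contra hcon
  have hmem : ∀ f ∈ Submonoid.closure S, IsWEndo f := fun f hf => by
    have : f ∈ (Submonoid.closure S : Set (Function.End (Fin (N + 1)))) := hf
    rwa [hS] at this
  have key : ∀ f ∈ Submonoid.closure S, IsAut f → f = 1 := by
    intro f hf
    induction hf using Submonoid.closure_induction with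
    | mem s hs =>
      rintro (h | h)
      · exact h
      · exact absurd (h ▸ hs) hcon
    | one => exact fun _ => rfl
    | mul f g hf hg ihf ihg =>
      intro h
      have hg1 := ihg (isAut_of_mul_right (hmem g hg) h)
      rw [hg1, mul_one] at h ⊢
      exact ihf h
  have hr : refl N ∈ (Submonoid.closure S : Set (Function.End (Fin (N + 1)))) := by
    rw [hS]; exact isWEndo_gen (.inl ())
  exact refl_ne_one hN (key _ hr (Or.inr rfl))

/-- Up to an automorphism, `s` collapses and turns where the generator of index `κ` does. -/
def HasType (κ : Index) (s : Function.End (Fin (N + 1))) : Prop :=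
  ∃ u, IsAut u ∧ flats (s * u) = indexFlats κ ∧ turns (s * u) = indexTurns κ

theorem exists_hasType (hN : 1 ≤ N) {S : Set (Function.End (Fin (N + 1)))}
    (hS : (Submonoid.closure S : Set (Function.End (Fin (N + 1)))) = {f | IsWEndo f})
    {κ : Index} (hκ : κ ∈ indices N) : ∃ s ∈ S, HasType κ s := by
  by_cases h₀ : κ = .inl ()
  · subst h₀
    refine ⟨refl N, refl_mem_of_closure hN hS, 1, Or.inl rfl, ?_, ?_⟩ <;> rw [mul_one]
    · exact Set.subset_empty_iff.1 (flats_gen_subset hκ)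
    · exact Set.subset_empty_iff.1 (turns_gen_subset hκ)
  · have hmem : gen N κ ∈ (Submonoid.closure S : Set (Function.End (Fin (N + 1)))) := by
      rw [hS]; exact isWEndo_gen κ
    have hsub : ∀ s ∈ S, IsWEndo s := fun s hs => by
      have : s ∈ (Submonoid.closure S : Set (Function.End (Fin (N + 1)))) :=
        Submonoid.subset_closure hs
      rwa [hS] at this
    rcases exists_factor hmem with h | ⟨s, hs, u, h, hu, hsu, hgen⟩
    · exact absurd h (not_isAut_gen hκ h₀)
    · refine ⟨s, hs, u, hu, flats_turns_of_gen_eq_mul hκ h₀ (isWEndo_mul (hsub s hs) ?_) hsu hgen⟩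
      rcases hu with rfl | rfl
      · exact isWEndo_one
      · exact isWEndo_gen (.inl ())

theorem index_eq_of_eq {κ κ' : Index} (hκ : κ ∈ indices N) (hκ' : κ' ∈ indices N)
    (hF : indexFlats κ = indexFlats κ') (hT : indexTurns κ = indexTurns κ') : κ = κ' := by
  rw [Set.ext_iff] at hF hT
  rcases κ with _ | i | a | ⟨j, k⟩ <;> rcases κ' with _ | i' | a' | ⟨j', k'⟩ <;>
    simp [indices] at hκ hκ' <;>
    simp only [indexFlats, indexTurns, Set.mem_singleton_iff, Set.mem_insert_iff,
      Set.mem_empty_iff_false] at hF hT <;>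
    simp only [reduceCtorEq, Sum.inr.injEq, Sum.inl.injEq, Sigma.mk.injEq, heq_eq_eq]
  · simpa using hF i'
  · simpa using hT (a' - 1)
  · simpa using hT (j' + k')
  · simpa using hF i
  · simpa using hF i
  · simpa using hF i
  · simpa using hF i
  · simpa using hT (a - 1)
  · simpa using hF i'
  · have := hT (a - 1); omega
  · have := hT (j' + k'); have := hT (2 * j' + k'); omega
  · simpa using hT (j + k)
  · simpa using hF i'
  · have := hT (j + k); have := hT (2 * j + k); omega
  · have := hT (j + k); have := hT (2 * j + k)
    have := hT (j' + k'); have := hT (2 * j' + k'); omega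

theorem index_eq_of_reflect {κ κ' : Index} (hκ : κ ∈ indices N) (hκ' : κ' ∈ indices N)
    (hF : ∀ x, x ∈ indexFlats κ' ↔ x + 1 ≤ N ∧ N - 1 - x ∈ indexFlats κ)
    (hT : ∀ x, x ∈ indexTurns κ' ↔ x + 2 ≤ N ∧ N - 2 - x ∈ indexTurns κ) : κ = κ' := by
  rcases κ with _ | i | a | ⟨j, k⟩ <;> rcases κ' with _ | i' | a' | ⟨j', k'⟩ <;>
    simp [indices] at hκ hκ' <;>
    simp only [indexFlats, indexTurns, Set.mem_singleton_iff, Set.mem_insert_iff,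
      Set.mem_empty_iff_false] at hF hT <;>
    simp only [reduceCtorEq, Sum.inr.injEq, Sum.inl.injEq, Sigma.mk.injEq, heq_eq_eq]
  · simpa using hF i'
  · simpa using hT (a' - 1)
  · simpa using hT (j' + k')
  · exact (hF (N - 1 - i)).2 ⟨by omega, by omega⟩
  · have := hF i'; omega
  · exact (hF (N - 1 - i)).2 ⟨by omega, by omega⟩
  · exact (hF (N - 1 - i)).2 ⟨by omega, by omega⟩
  · exact (hT (N - 2 - (a - 1))).2 ⟨by omega, by omega⟩
  · simpa using hF i'
  · have := hT (a' - 1); omega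
  · have := hT (j' + k'); have := hT (2 * j' + k'); omega
  · exact (hT (N - 2 - (j + k))).2 ⟨by omega, by omega⟩
  · simpa using hF i'
  · have := hT (N - 2 - (j + k)); have := hT (N - 2 - (2 * j + k)); omega
  · have := hT (j' + k'); have := hT (2 * j' + k')
    have := hT (N - 2 - (j + k)); have := hT (N - 2 - (2 * j + k)); omega

theorem HasType.index_eq {κ κ' : Index} (hκ : κ ∈ indices N) (hκ' : κ' ∈ indices N)
    {s : Function.End (Fin (N + 1))} (h : HasType κ s) (h' : HasType κ' s) : κ = κ' := by
  obtain ⟨u, hu, hF, hT⟩ := h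
  obtain ⟨u', hu', hF', hT'⟩ := h'
  have hcase : u' = u ∨ u' = u * refl N := by
    rcases hu with rfl | rfl <;> rcases hu' with rfl | rfl
    · exact Or.inl rfl
    · exact Or.inr (one_mul _).symm
    · exact Or.inr refl_mul_refl.symm
    · exact Or.inl rfl
  rcases hcase with rfl | rfl
  · exact index_eq_of_eq hκ hκ' (hF.symm.trans hF') (hT.symm.trans hT')
  · rw [← mul_assoc] at hF' hT'
    refine index_eq_of_reflect hκ hκ' (fun x => ?_) fun x => ?_
    · rw [← hF', ← hF, mem_flats_mul_refl]
    · rw [← hT', ← hT, mem_turns_mul_refl]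

theorem card_indices_le_ncard (hN : 1 ≤ N) {S : Set (Function.End (Fin (N + 1)))}
    (hS : (Submonoid.closure S : Set (Function.End (Fin (N + 1)))) = {f | IsWEndo f}) :
    (indices N).card ≤ S.ncard := by
  have hfin : S.Finite := @Set.toFinite _ S (Subtype.finite (α := Fin (N + 1) → Fin (N + 1)))
  choose! σ hσS hσ using fun (κ : Index) (hκ : κ ∈ indices N) => exists_hasType hN hS hκ
  rw [← Set.ncard_coe_finset]
  exact Set.ncard_le_ncard_of_injOn σ hσS (fun κ hκ κ' hκ' he =>
    HasType.index_eq hκ hκ' (hσ κ hκ) (he ▸ hσ κ' hκ')) hfin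

end WEndPath

/-- The rank of the monoid `wEnd P_n` is `n + ∑_{j=1}^{⌊(n-3)/3⌋} ⌊(n-3j-1)/2⌋`. -/
theorem rank_wEnd_path (n : ℕ) (hn : 2 ≤ n) :
    IsLeast {k : ℕ | ∃ S : Set (Function.End (Fin n)),
        (Submonoid.closure S : Set (Function.End (Fin n))) = {f | IsWEndo f} ∧ S.ncard = k}
      (n + ∑ j ∈ Finset.Icc 1 ((n - 3) / 3), (n - 3 * j - 1) / 2) := by
  obtain ⟨N, rfl⟩ : ∃ N, n = N + 1 := ⟨n - 1, by omega⟩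
  have hN : 1 ≤ N := by omega
  have hcard : N + 1 + ∑ j ∈ Finset.Icc 1 ((N + 1 - 3) / 3), (N + 1 - 3 * j - 1) / 2 =
      (WEndPath.indices N).card := by
    rw [WEndPath.card_indices, show N + 1 - 3 = N - 2 by omega]
    congr 1
    exact Finset.sum_congr rfl fun j _ => by congr 1; omega
  rw [hcard]
  constructor
  · refine ⟨_, WEndPath.closure_gen hN, le_antisymm ?_ ?_⟩
    · rw [← Set.ncard_coe_finset]
      exact Set.ncard_image_le (Finset.finite_toSet _)
    · exact WEndPath.card_indices_le_ncard hN (WEndPath.closure_gen hN)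
  · rintro _ ⟨S, hS, rfl⟩
    exact WEndPath.card_indices_le_ncard hN hS
end

section
/- For n ≥ 2, the rank of the monoid swEnd P_n (i.e. the minimum cardinality of a generating set of swEnd P_n) is equal to ⌈n/2⌉ + 1. -/
/-- `{u,v}` is an edge of the path `P_n` (vertices `0,…,n-1` standing for `1,…,n`). -/
def pathAdj {n : ℕ} (u v : Fin n) : Prop := |((u : ℕ) : ℤ) - ((v : ℕ) : ℤ)| = 1

/-- `α` is a strong weak endomorphism of the path `P_n`. -/
def IsSWEndo {n : ℕ} (f : Function.End (Fin n)) : Prop :=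
  ∀ u v : Fin n, (pathAdj u v ∧ f u ≠ f v) ↔ pathAdj (f u) (f v)

theorem pathAdj_iff {n : ℕ} (u v : Fin n) :
    pathAdj u v ↔ (u : ℕ) = v + 1 ∨ (v : ℕ) = u + 1 := by
  rw [pathAdj, abs_eq one_pos.le]
  omega

instance {n : ℕ} (u v : Fin n) : Decidable (pathAdj u v) :=
  decidable_of_iff _ (pathAdj_iff u v).symm

/-- The reflection of the path `P_n`. -/
def pathRev {n : ℕ} : Function.End (Fin n) := fun i ↦ i.rev

/-- The constant map with value `c`. -/
def constEnd {n : ℕ} (c : Fin n) : Function.End (Fin n) := fun _ ↦ c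

theorem isSWEndo_one {n : ℕ} : IsSWEndo (1 : Function.End (Fin n)) := by
  intro u v
  simp only [Function.End.one_def, id, pathAdj_iff, ne_eq, Fin.ext_iff]
  omega

theorem isSWEndo_pathRev {n : ℕ} : IsSWEndo (pathRev : Function.End (Fin n)) := by
  intro u v
  simp only [pathRev, pathAdj_iff, ne_eq, Fin.ext_iff, Fin.val_rev]
  omega

theorem isSWEndo_constEnd {n : ℕ} (c : Fin n) : IsSWEndo (constEnd c) := by
  intro u v
  simp [constEnd, pathAdj_iff]

/-- On a path with `n ≠ 3` vertices, a strong weak endomorphism that separates some pair of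
adjacent vertices moves by a fixed step `d = ±1`. -/
theorem IsSWEndo.exists_step {n : ℕ} (h3 : n ≠ 3) {f : Function.End (Fin n)} (hf : IsSWEndo f)
    {F : ℕ → ℕ} (hF : ∀ i : Fin n, F i = f i)
    (hne : ∃ k, k + 1 < n ∧ F k ≠ F (k + 1)) :
    ∃ d : ℤ, (d = 1 ∨ d = -1) ∧ ∀ k, k < n → (F k : ℤ) = F 0 + d * k := by
  have key : ∀ u v, u < n → v < n →
      (((u = v + 1 ∨ v = u + 1) ∧ F u ≠ F v) ↔ (F u = F v + 1 ∨ F v = F u + 1)) := by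
    intro u v hu hv
    have h := hf ⟨u, hu⟩ ⟨v, hv⟩
    simpa only [pathAdj_iff, ne_eq, Fin.ext_iff, ← hF] using h
  have succ_ne : ∀ k, k + 2 < n → (F k ≠ F (k + 1) ↔ F (k + 1) ≠ F (k + 2)) := by
    intro k hk
    have h1 := key k (k + 1) (by omega) (by omega)
    have h2 := key (k + 1) (k + 2) (by omega) (by omega)
    have h3 := key k (k + 2) (by omega) (by omega)
    omega
  have ne_iff : ∀ k, k + 1 < n → (F k ≠ F (k + 1) ↔ F 0 ≠ F 1) := by
    intro k
    induction k with
    | zero => simp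
    | succ k ih => intro hk; rw [← succ_ne k hk, ih (by omega)]
  obtain ⟨k₀, hk₀, hne₀⟩ := hne
  have all_ne : ∀ k, k + 1 < n → F k ≠ F (k + 1) :=
    fun k hk ↦ (ne_iff k hk).2 ((ne_iff k₀ hk₀).1 hne₀)
  have adj : ∀ k, k + 1 < n → F k = F (k + 1) + 1 ∨ F (k + 1) = F k + 1 :=
    fun k hk ↦ (key k (k + 1) (by omega) hk).1 ⟨Or.inr rfl, all_ne k hk⟩
  have no_fold : ∀ k, k + 2 < n → F k ≠ F (k + 2) := by
    intro k hk heq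
    rcases Nat.eq_zero_or_pos k with rfl | hpos
    · have h1 := adj 2 (by omega)
      have h2 := key 0 3 (by omega) (by omega)
      simp only [Nat.reduceAdd] at *
      omega
    · obtain ⟨j, rfl⟩ : ∃ j, k = j + 1 := ⟨k - 1, by omega⟩
      have h1 := adj j (by omega)
      have h2 := key j (j + 1 + 2) (by omega) (by omega)
      omega
  have step : ∀ k, k + 1 < n → (F (k + 1) : ℤ) - F k = F 1 - F 0 := by
    intro k
    induction k with
    | zero => simp
    | succ k ih =>
      intro hk
      have h1 := ih (by omega)
      have h2 := adj k (by omega)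
      have h3 := adj (k + 1) hk
      have h4 := no_fold k hk
      rw [← h1]
      simp only [add_assoc, Nat.reduceAdd] at *
      omega
  refine ⟨(F 1 : ℤ) - F 0, ?_, ?_⟩
  · have := adj 0 (by omega)
    simp only [zero_add] at this
    omega
  · intro k
    induction k with
    | zero => simp
    | succ k ih =>
      intro hk
      have h1 := ih (by omega)
      have h2 := step k hk
      push_cast
      linarith

theorem IsSWEndo.eq_one_or_eq_pathRev_or_eq_constEnd {n : ℕ} (hn : 2 ≤ n) (h3 : n ≠ 3)
    {f : Function.End (Fin n)} (hf : IsSWEndo f) :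
    f = 1 ∨ f = pathRev ∨ ∃ c, f = constEnd c := by
  let F : ℕ → ℕ := fun k ↦ if h : k < n then f ⟨k, h⟩ else 0
  have hF : ∀ i : Fin n, F i = f i := fun i ↦ by simp [F]
  have F_lt : ∀ k, k < n → F k < n := fun k hk ↦ by simp [F, hk]
  by_cases hne : ∃ k, k + 1 < n ∧ F k ≠ F (k + 1)
  · obtain ⟨d, hd, hlin⟩ := hf.exists_step h3 hF hne
    have h0 := F_lt 0 (by omega)
    have hlast := hlin (n - 1) (by omega)
    have hlast_lt := F_lt (n - 1) (by omega)
    rcases hd with rfl | rfl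
    · left
      funext i
      have := hlin i i.2
      rw [Fin.ext_iff, ← hF, Function.End.one_def, id]
      omega
    · right; left
      funext i
      have := hlin i i.2
      have := i.2
      rw [Fin.ext_iff, ← hF, pathRev, Fin.val_rev]
      omega
  · push Not at hne
    right; right
    have hc : ∀ k, k < n → F k = F 0 := by
      intro k
      induction k with
      | zero => simp
      | succ k ih => intro hk; rw [← hne k hk, ih (by omega)]
    refine ⟨f ⟨0, by omega⟩, ?_⟩
    funext i
    rw [constEnd, Fin.ext_iff, ← hF, ← hF]
    exact hc i i.2

/-- A subset of a monoid that contains a product of elements of `closure S` only if it contains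
a factor, and does not contain `1`, meets every set `S` whose closure it meets. -/
theorem Submonoid.exists_mem_of_mem_closure {M : Type*} [Monoid M] {S T : Set M}
    (h1 : (1 : M) ∉ T)
    (hmul : ∀ f ∈ closure S, ∀ g ∈ closure S, f * g ∈ T → f ∈ T ∨ g ∈ T)
    {x : M} (hx : x ∈ closure S) (hxT : x ∈ T) : ∃ s ∈ S, s ∈ T := by
  by_contra! h
  induction hx using closure_induction with
  | mem s hs => exact h s hs hxT
  | one => exact h1 hxT
  | mul f g hf hg ihf ihg => exact (hmul f hf g hg hxT).elim ihf ihg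

theorem Submonoid.card_le_ncard_of_closure {M ι : Type*} [Monoid M] [Finite M] [Fintype ι]
    {S : Set M} (T : ι → Set M) (hdisj : Pairwise (Function.onFun Disjoint T))
    (h1 : ∀ i, (1 : M) ∉ T i)
    (hmul : ∀ i, ∀ f ∈ closure S, ∀ g ∈ closure S, f * g ∈ T i → f ∈ T i ∨ g ∈ T i)
    (hne : ∀ i, ∃ x ∈ closure S, x ∈ T i) : Fintype.card ι ≤ S.ncard := by
  choose s hs hsT using fun i ↦
    let ⟨_, hx, hxT⟩ := hne i
    exists_mem_of_mem_closure (h1 i) (hmul i) hx hxT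
  have hinj : Function.Injective s := by
    intro i j hij
    by_contra hne
    exact Set.disjoint_left.1 (hdisj hne) (hsT i) (hij ▸ hsT j)
  rw [← Nat.card_eq_fintype_card, ← Set.ncard_range_of_injective hinj]
  exact Set.ncard_le_ncard (Set.range_subset_iff.2 hs) S.toFinite

/-- The reflection together with the constant maps onto the first half of the path. -/
def swGen {n : ℕ} : Option (Fin ((n + 1) / 2)) → Function.End (Fin n)
  | none => pathRev
  | some i => constEnd ⟨i, by omega⟩

theorem pathRev_ne_constEnd {n : ℕ} (hn : 2 ≤ n) (c : Fin n) : pathRev ≠ constEnd c := by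
  intro h
  have h0 := congrArg Fin.val (congrFun h ⟨0, by omega⟩)
  have h1 := congrArg Fin.val (congrFun h ⟨1, by omega⟩)
  simp only [pathRev, constEnd, Fin.val_rev] at h0 h1
  omega

theorem one_ne_constEnd {n : ℕ} (hn : 2 ≤ n) (c : Fin n) : 1 ≠ constEnd c := by
  intro h
  have h0 := congrArg Fin.val (congrFun h ⟨0, by omega⟩)
  have h1 := congrArg Fin.val (congrFun h ⟨1, by omega⟩)
  simp only [Function.End.one_def, id, constEnd] at h0 h1
  omega

theorem one_ne_pathRev {n : ℕ} (hn : 2 ≤ n) : (1 : Function.End (Fin n)) ≠ pathRev := by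
  intro h
  have h0 := congrArg Fin.val (congrFun h ⟨0, by omega⟩)
  simp only [Function.End.one_def, id, pathRev, Fin.val_rev] at h0
  omega

theorem constEnd_injective {n : ℕ} (hn : 2 ≤ n) :
    Function.Injective (constEnd : Fin n → Function.End (Fin n)) :=
  fun _ _ h ↦ congrFun h ⟨0, by omega⟩

theorem constEnd_mul {n : ℕ} (c : Fin n) (f : Function.End (Fin n)) :
    constEnd c * f = constEnd c := rfl

theorem mul_constEnd {n : ℕ} (c : Fin n) (f : Function.End (Fin n)) :
    f * constEnd c = constEnd (f c) := rfl

theorem pathRev_mul_pathRev {n : ℕ} : (pathRev * pathRev : Function.End (Fin n)) = 1 := by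
  funext i
  exact Fin.rev_rev i

theorem swGen_injective {n : ℕ} (hn : 2 ≤ n) : Function.Injective (swGen (n := n)) := by
  rintro (_ | i) (_ | j) h
  · rfl
  · exact (pathRev_ne_constEnd hn _ h).elim
  · exact (pathRev_ne_constEnd hn _ h.symm).elim
  · have := congrArg Fin.val (constEnd_injective hn h)
    exact congrArg some (Fin.ext this)

/-- The submonoid of strong weak endomorphisms when `n ≠ 3`. -/
def swSubmonoid (n : ℕ) : Submonoid (Function.End (Fin n)) where
  carrier := {f | f = 1 ∨ f = pathRev ∨ ∃ c, f = constEnd c}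
  one_mem' := Or.inl rfl
  mul_mem' := by
    rintro f g (rfl | rfl | ⟨c, rfl⟩) (rfl | rfl | ⟨d, rfl⟩) <;>
      simp [constEnd_mul, mul_constEnd, pathRev_mul_pathRev]

theorem coe_swSubmonoid {n : ℕ} (hn : 2 ≤ n) (h3 : n ≠ 3) :
    (swSubmonoid n : Set (Function.End (Fin n))) = {f | IsSWEndo f} := by
  ext f
  constructor
  · rintro (rfl | rfl | ⟨c, rfl⟩)
    exacts [isSWEndo_one, isSWEndo_pathRev, isSWEndo_constEnd c]
  · exact fun hf ↦ hf.eq_one_or_eq_pathRev_or_eq_constEnd hn h3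

theorem closure_range_swGen (n : ℕ) :
    Submonoid.closure (Set.range swGen) = swSubmonoid n := by
  apply le_antisymm
  · rw [Submonoid.closure_le]
    rintro _ ⟨_ | i, rfl⟩
    exacts [Or.inr (Or.inl rfl), Or.inr (Or.inr ⟨_, rfl⟩)]
  · have hrev : (pathRev : Function.End (Fin n)) ∈ Submonoid.closure (Set.range swGen) :=
      Submonoid.subset_closure ⟨none, rfl⟩
    rintro f (rfl | rfl | ⟨c, rfl⟩)
    · exact one_mem _
    · exact hrev
    · by_cases hc : (c : ℕ) < (n + 1) / 2
      · exact Submonoid.subset_closure ⟨some ⟨c, hc⟩, rfl⟩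
      · have hc' : (c.rev : ℕ) < (n + 1) / 2 := by rw [Fin.val_rev]; omega
        have h := mul_mem hrev (Submonoid.subset_closure ⟨some ⟨c.rev, hc'⟩, rfl⟩)
        simpa only [swGen, mul_constEnd, pathRev, Fin.eta, Fin.rev_rev] using h

/-- The class of the generator `swGen o` under multiplication by the reflection. -/
def swClass {n : ℕ} : Option (Fin ((n + 1) / 2)) → Set (Function.End (Fin n))
  | none => {pathRev}
  | some i => {f | ∃ c : Fin n, ((c : ℕ) = i ∨ (c.rev : ℕ) = i) ∧ f = constEnd c}

theorem pairwise_disjoint_swClass {n : ℕ} (hn : 2 ≤ n) :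
    Pairwise (Function.onFun Disjoint (swClass (n := n))) := by
  rintro (_ | i) (_ | j) hij <;> refine Set.disjoint_left.2 ?_
  · exact (hij rfl).elim
  · rintro _ rfl ⟨c, -, h⟩
    exact pathRev_ne_constEnd hn c h
  · rintro _ ⟨c, -, h⟩ rfl
    exact pathRev_ne_constEnd hn c h
  · rintro _ ⟨c, hc, rfl⟩ ⟨d, hd, h⟩
    obtain rfl := constEnd_injective hn h
    refine hij (congrArg some (Fin.ext ?_))
    simp only [Fin.val_rev] at hc hd
    omega

theorem mem_or_mem_swClass_of_mul_mem {n : ℕ} (hn : 2 ≤ n) (o : Option (Fin ((n + 1) / 2)))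
    {f g : Function.End (Fin n)} (hf : f ∈ swSubmonoid n) (hg : g ∈ swSubmonoid n)
    (h : f * g ∈ swClass o) : f ∈ swClass o ∨ g ∈ swClass o := by
  rcases hf with rfl | rfl | ⟨c, rfl⟩
  · exact Or.inr (by rwa [one_mul] at h)
  · rcases hg with rfl | rfl | ⟨d, rfl⟩
    · exact Or.inl (by rwa [mul_one] at h)
    · rw [pathRev_mul_pathRev] at h
      rcases o with _ | i
      · exact Or.inl rfl
      · obtain ⟨c, -, hc⟩ := h
        exact (one_ne_constEnd hn c hc).elim
    · rw [mul_constEnd] at h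
      rcases o with _ | i
      · exact Or.inl rfl
      · obtain ⟨c, hc, hdc⟩ := h
        obtain rfl := constEnd_injective hn hdc
        refine Or.inr ⟨d, ?_, rfl⟩
        simpa [pathRev, or_comm] using hc
  · exact Or.inl h

theorem add_one_le_ncard_of_closure_eq {n : ℕ} (hn : 2 ≤ n) {S : Set (Function.End (Fin n))}
    (hS : Submonoid.closure S = swSubmonoid n) : (n + 1) / 2 + 1 ≤ S.ncard := by
  have : Finite (Function.End (Fin n)) := inferInstanceAs (Finite (Fin n → Fin n))
  have h := Submonoid.card_le_ncard_of_closure (S := S) swClass (pairwise_disjoint_swClass hn)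
    ?_ ?_ ?_
  · simpa using h
  · rintro (_ | i)
    · exact one_ne_pathRev hn
    · rintro ⟨c, -, hc⟩
      exact one_ne_constEnd hn c hc
  · rw [hS]
    exact fun o f hf g hg ↦ mem_or_mem_swClass_of_mul_mem hn o hf hg
  · rw [hS]
    rintro (_ | i)
    · exact ⟨pathRev, Or.inr (Or.inl rfl), rfl⟩
    · exact ⟨constEnd ⟨i, by omega⟩, Or.inr (Or.inr ⟨_, rfl⟩), _, Or.inl rfl, rfl⟩

section Three

instance {n : ℕ} : DecidableEq (Function.End (Fin n)) :=
  inferInstanceAs (DecidableEq (Fin n → Fin n))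

instance {n : ℕ} : Fintype (Function.End (Fin n)) := inferInstanceAs (Fintype (Fin n → Fin n))

instance {n : ℕ} : DecidablePred (IsSWEndo (n := n)) := fun (f : Fin n → Fin n) ↦
  inferInstanceAs (Decidable (∀ u v : Fin n, (pathAdj u v ∧ f u ≠ f v) ↔ pathAdj (f u) (f v)))

/-- A map of rank two folding `P_3`. -/
def foldEnd : Function.End (Fin 3) := ![1, 0, 1]

theorem pathRev_ne_foldEnd : pathRev ≠ foldEnd :=
  fun h ↦ absurd (congrFun h 0) (by decide)

theorem foldEnd_ne_constEnd : foldEnd ≠ constEnd 0 :=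
  fun h ↦ absurd (congrFun h 0) (by decide)

theorem isSWEndo_three_mul (f g : Function.End (Fin 3)) (hf : IsSWEndo f) (hg : IsSWEndo g) :
    IsSWEndo (f * g) := by
  revert f g
  decide +kernel

theorem isSWEndo_three_cases (f : Function.End (Fin 3)) (hf : IsSWEndo f) :
    f = 1 ∨ f = pathRev ∨ f = foldEnd ∨ f = foldEnd * foldEnd ∨ f = pathRev * foldEnd ∨
      f = pathRev * (foldEnd * foldEnd) ∨ f = constEnd 0 ∨ f = foldEnd * constEnd 0 ∨
      f = pathRev * constEnd 0 := by
  revert f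
  decide +kernel

theorem closure_three :
    (Submonoid.closure {pathRev, foldEnd, constEnd 0} : Set (Function.End (Fin 3))) =
      {f | IsSWEndo f} := by
  apply Set.Subset.antisymm
  · intro f hf
    induction hf using Submonoid.closure_induction with
    | mem f hf =>
      rcases hf with rfl | rfl | rfl
      · exact isSWEndo_pathRev
      · exact show IsSWEndo foldEnd by decide +kernel
      · exact isSWEndo_constEnd 0
    | one => exact isSWEndo_one
    | mul f g _ _ ihf ihg => exact isSWEndo_three_mul f g ihf ihg
  · intro f hf
    have hr : pathRev ∈ Submonoid.closure {pathRev, foldEnd, constEnd 0} :=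
      Submonoid.subset_closure (by simp)
    have hd : foldEnd ∈ Submonoid.closure {pathRev, foldEnd, constEnd 0} :=
      Submonoid.subset_closure (by simp)
    have hc : constEnd 0 ∈ Submonoid.closure {pathRev, foldEnd, constEnd 0} :=
      Submonoid.subset_closure (by simp)
    rcases isSWEndo_three_cases f hf with h | h | h | h | h | h | h | h | h <;> subst h
    exacts [one_mem _, hr, hd, mul_mem hd hd, mul_mem hr hd, mul_mem hr (mul_mem hd hd), hc,
      mul_mem hd hc, mul_mem hr hc]

/-- The non-identity maps of `Fin 3` with `i + 1` elements in their image. -/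
def rankClass (i : Fin 3) : Set (Function.End (Fin 3)) :=
  {f | f ≠ 1 ∧ (Finset.univ.image (f : Fin 3 → Fin 3)).card = i + 1}

instance (i : Fin 3) : DecidablePred (· ∈ rankClass i) := fun f ↦
  decidable_of_iff (f ≠ 1 ∧ (Finset.univ.image (f : Fin 3 → Fin 3)).card = i + 1) Iff.rfl

theorem mem_or_mem_rankClass (i : Fin 3) (f g : Function.End (Fin 3))
    (hf : IsSWEndo f) (hg : IsSWEndo g) (h : f * g ∈ rankClass i) :
    f ∈ rankClass i ∨ g ∈ rankClass i := by
  revert i f g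
  decide +kernel

theorem exists_mem_rankClass (i : Fin 3) :
    ∃ f : Function.End (Fin 3), IsSWEndo f ∧ f ∈ rankClass i := by
  revert i
  decide +kernel

theorem three_le_ncard {S : Set (Function.End (Fin 3))}
    (hS : (Submonoid.closure S : Set (Function.End (Fin 3))) = {f | IsSWEndo f}) :
    3 ≤ S.ncard := by
  have : Finite (Function.End (Fin 3)) := inferInstanceAs (Finite (Fin 3 → Fin 3))
  have hmem : ∀ f, f ∈ Submonoid.closure S ↔ IsSWEndo f := fun f ↦ Set.ext_iff.1 hS f
  refine Submonoid.card_le_ncard_of_closure (S := S) rankClass ?_ ?_ ?_ ?_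
  · intro i j hij
    refine Set.disjoint_left.2 fun f hi hj ↦ hij (Fin.ext ?_)
    have := hi.2.symm.trans hj.2
    omega
  · exact fun i h ↦ h.1 rfl
  · intro i f hf g hg
    exact mem_or_mem_rankClass i f g ((hmem f).1 hf) ((hmem g).1 hg)
  · intro i
    obtain ⟨f, hf, hfi⟩ := exists_mem_rankClass i
    exact ⟨f, (hmem f).2 hf, hfi⟩

end Three

/-- The rank of the monoid `swEnd P_n` is `⌈n/2⌉ + 1`. -/
theorem rank_swEnd_path (n : ℕ) (hn : 2 ≤ n) :
    IsLeast {k : ℕ | ∃ S : Set (Function.End (Fin n)),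
        (Submonoid.closure S : Set (Function.End (Fin n))) = {f | IsSWEndo f} ∧ S.ncard = k}
      ((n + 1) / 2 + 1) := by
  rcases eq_or_ne n 3 with rfl | h3
  · refine ⟨⟨_, closure_three, ?_⟩, ?_⟩
    · exact Set.ncard_eq_three.2 ⟨_, _, _, pathRev_ne_foldEnd, pathRev_ne_constEnd hn 0,
        foldEnd_ne_constEnd, rfl⟩
    · rintro k ⟨S, hS, rfl⟩
      exact three_le_ncard hS
  · rw [← coe_swSubmonoid hn h3]
    refine ⟨⟨_, congrArg _ (closure_range_swGen n), ?_⟩, ?_⟩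
    · rw [Set.ncard_range_of_injective (swGen_injective hn)]
      simp
    · rintro k ⟨S, hS, rfl⟩
      exact add_one_le_ncard_of_closure_eq hn (SetLike.coe_injective hS)
end

section
/- The set A = {τ} ∪ {α_i : i = 1,…,⌊(n−1)/2⌋} ∪ {β_{j,i} : j = 1,…,⌊(n−3)/3⌋, i = 1,…,⌊(n−3j−1)/2⌋} generates the monoid End P_n, and |A| = 1 + ⌊(n−1)/2⌋ + Σ_{j=1}^{⌊(n−3)/3⌋} ⌊(n−3j−1)/2⌋. -/
/-- The reversal map `τ` of `{1,…,n}`, `xτ = n - x + 1` (in `0`-indexed form: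
`x ↦ n - 1 - x`). -/
def pathTau (n : ℕ) : Function.End (Fin n) :=
  fun x => ⟨(n - 1 - (x : ℕ)) % n, Nat.mod_lt _ x.pos⟩

/-- The transformation `α_i` of `{1,…,n}`: `xα_i = i + 2 - x` for `1 ≤ x ≤ i+1` and
`xα_i = x - i` for `i+1 ≤ x ≤ n`.  In `0`-indexed form this is `x ↦ |x - i|`
(the `% n` is the identity in the considered range `1 ≤ i ≤ n-2`). -/
def pathAlpha (n i : ℕ) : Function.End (Fin n) :=
  fun x => ⟨(if (x : ℕ) ≤ i then i - (x : ℕ) else (x : ℕ) - i) % n, Nat.mod_lt _ x.pos⟩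

/-- The transformation `β_{j,i}` of `{1,…,n}`: `xβ = x` for `1 ≤ x ≤ i+j+1`,
`xβ = 2(i+j+1) - x` for `i+j+1 ≤ x ≤ i+2j+1`, and `xβ = x - 2j` for `i+2j+1 ≤ x ≤ n`.
(`0`-indexed below; the `% n` is the identity in the considered ranges of `i,j`.) -/
def pathBeta (n j i : ℕ) : Function.End (Fin n) :=
  fun x => ⟨(if (x : ℕ) ≤ i + j then (x : ℕ)
      else if (x : ℕ) ≤ i + 2 * j then 2 * (i + j) - (x : ℕ)
      else (x : ℕ) - 2 * j) % n, Nat.mod_lt _ x.pos⟩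

/-- The set `A = {τ} ∪ {α_i : 1 ≤ i ≤ ⌊(n-1)/2⌋} ∪
{β_{j,i} : 1 ≤ j ≤ ⌊(n-3)/3⌋, 1 ≤ i ≤ ⌊(n-3j-1)/2⌋}`. -/
def genA (n : ℕ) : Set (Function.End (Fin n)) :=
  {pathTau n} ∪ {g | ∃ i, 1 ≤ i ∧ i ≤ (n - 1) / 2 ∧ g = pathAlpha n i}
    ∪ {g | ∃ j, 1 ≤ j ∧ j ≤ (n - 3) / 3 ∧
        ∃ i, 1 ≤ i ∧ i ≤ (n - 3 * j - 1) / 2 ∧ g = pathBeta n j i}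

theorem pathTau_val {n : ℕ} (x : Fin n) : (pathTau n x : ℕ) = n - 1 - x := by
  have := x.isLt
  exact Nat.mod_eq_of_lt (by omega)

theorem pathAlpha_val {n i : ℕ} (hi : i < n) (x : Fin n) :
    (pathAlpha n i x : ℕ) = if (x : ℕ) ≤ i then i - (x : ℕ) else (x : ℕ) - i := by
  have := x.isLt
  exact Nat.mod_eq_of_lt (by split_ifs <;> omega)

theorem pathBeta_val {n : ℕ} (j i : ℕ) (x : Fin n) :
    (pathBeta n j i x : ℕ) = if (x : ℕ) ≤ i + j then (x : ℕ)
      else if (x : ℕ) ≤ i + 2 * j then 2 * (i + j) - (x : ℕ)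
      else (x : ℕ) - 2 * j := by
  have := x.isLt
  exact Nat.mod_eq_of_lt (by split_ifs <;> omega)

theorem IsEndo.one {n : ℕ} : IsEndo (1 : Function.End (Fin n)) := by
  intro i h
  change |(i : ℤ) - ((i + 1 : ℕ) : ℤ)| = 1
  simp

theorem IsEndo.mul {n : ℕ} {f g : Function.End (Fin n)} (hf : IsEndo f) (hg : IsEndo g) :
    IsEndo (f * g) := by
  intro i h
  have hgi := hg i h
  have key : ∀ a b : Fin n, (a : ℕ) + 1 = b → |((f a : ℕ) : ℤ) - ((f b : ℕ) : ℤ)| = 1 := by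
    rintro ⟨a, ha⟩ ⟨b, hb⟩ hab
    obtain rfl : a + 1 = b := hab
    exact hf a hb
  change |((f (g ⟨i, _⟩) : ℕ) : ℤ) - ((f (g ⟨i + 1, h⟩) : ℕ) : ℤ)| = 1
  rcases (abs_eq zero_le_one).1 hgi with h1 | h1
  · rw [abs_sub_comm]
    exact key _ _ (by omega)
  · exact key _ _ (by omega)

theorem isEndo_pathTau (n : ℕ) : IsEndo (pathTau n) := by
  intro i h
  rw [pathTau_val, pathTau_val, abs_eq zero_le_one]
  dsimp only
  omega

theorem isEndo_pathAlpha {n i : ℕ} (hi : i < n) : IsEndo (pathAlpha n i) := by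
  intro k h
  rw [pathAlpha_val hi, pathAlpha_val hi, abs_eq zero_le_one]
  dsimp only
  split_ifs <;> omega

theorem isEndo_pathBeta (n j i : ℕ) : IsEndo (pathBeta n j i) := by
  intro k h
  rw [pathBeta_val, pathBeta_val, abs_eq zero_le_one]
  dsimp only
  split_ifs <;> omega

theorem isEndo_of_mem_closure_genA {n : ℕ} {f : Function.End (Fin n)}
    (hf : f ∈ Submonoid.closure (genA n)) : IsEndo f := by
  induction hf using Submonoid.closure_induction with
  | mem f hf =>
    rcases hf with (rfl | ⟨i, hi, hi', rfl⟩) | ⟨j, -, -, i, -, -, rfl⟩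
    · exact isEndo_pathTau n
    · exact isEndo_pathAlpha (by omega)
    · exact isEndo_pathBeta n j i
  | one => exact IsEndo.one
  | mul f g _ _ hf hg => exact hf.mul hg

theorem pathTau_mem_closure (n : ℕ) : pathTau n ∈ Submonoid.closure (genA n) :=
  Submonoid.subset_closure (Or.inl (Or.inl rfl))

theorem pathAlpha_mem_closure {n i : ℕ} (hi : i < n) :
    pathAlpha n i ∈ Submonoid.closure (genA n) := by
  have small : ∀ k, k ≤ (n - 1) / 2 → k < n → pathAlpha n k ∈ Submonoid.closure (genA n) := by
    intro k hk hkn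
    rcases Nat.eq_zero_or_pos k with rfl | hk0
    · have : pathAlpha n 0 = 1 := by
        funext x
        apply Fin.ext
        rw [pathAlpha_val hkn]
        change _ = (x : ℕ)
        split_ifs <;> omega
      rw [this]
      exact one_mem _
    · exact Submonoid.subset_closure (Or.inl (Or.inr ⟨k, hk0, hk, rfl⟩))
  by_cases h : i ≤ (n - 1) / 2
  · exact small i h hi
  · have hi' : n - 1 - i < n := by omega
    have : pathAlpha n i = pathAlpha n (n - 1 - i) * pathTau n := by
      funext x
      apply Fin.ext
      change _ = ((pathAlpha n (n - 1 - i) (pathTau n x) : Fin n) : ℕ)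
      rw [pathAlpha_val hi, pathAlpha_val hi', pathTau_val]
      have := x.isLt
      split_ifs <;> omega
    rw [this]
    exact mul_mem (small _ (by omega) hi') (pathTau_mem_closure n)

theorem pathBeta_mem_closure {n j i : ℕ} (hj : 1 ≤ j) (hi : 1 ≤ i) (hn : i + 3 * j + 2 ≤ n) :
    pathBeta n j i ∈ Submonoid.closure (genA n) := by
  by_cases h : i ≤ (n - 3 * j - 1) / 2
  · exact Submonoid.subset_closure (Or.inr ⟨j, hj, by omega, i, hi, h, rfl⟩)
  · have hk : pathBeta n j (n - 1 - 3 * j - i) ∈ Submonoid.closure (genA n) :=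
      Submonoid.subset_closure
        (Or.inr ⟨j, hj, by omega, n - 1 - 3 * j - i, by omega, by omega, rfl⟩)
    have : pathBeta n j i =
        pathAlpha n (2 * j) * (pathTau n * (pathBeta n j (n - 1 - 3 * j - i) * pathTau n)) := by
      funext x
      apply Fin.ext
      change _ = ((pathAlpha n (2 * j) (pathTau n (pathBeta n j (n - 1 - 3 * j - i)
        (pathTau n x))) : Fin n) : ℕ)
      rw [pathAlpha_val (by omega), pathTau_val, pathBeta_val, pathBeta_val, pathTau_val]
      have := x.isLt
      split_ifs <;> omega
    rw [this]
    exact mul_mem (pathAlpha_mem_closure (by omega))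
      (mul_mem (pathTau_mem_closure n) (mul_mem hk (pathTau_mem_closure n)))

/-- `w` takes steps of size one on `{0, …, m}`. -/
def IsWalk (m : ℕ) (w : ℕ → ℕ) : Prop :=
  ∀ i < m, w (i + 1) = w i + 1 ∨ w i = w (i + 1) + 1

theorem IsWalk.linear_of_no_turn {m : ℕ} {w : ℕ → ℕ} (hw : IsWalk m w) {a b : ℕ} (hb : b ≤ m)
    (hturn : ∀ t, a < t → t < b → w (t - 1) ≠ w (t + 1)) :
    (∀ i, a ≤ i → i ≤ b → w i = w a + (i - a)) ∨
      (∀ i, a ≤ i → i ≤ b → w i + (i - a) = w a) := by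
  induction b with
  | zero =>
    left
    intro i h1 h2
    obtain rfl : i = a := by omega
    simp
  | succ b ih =>
    have ih := ih (by omega) fun t h1 h2 => hturn t h1 (by omega)
    have hs := hw b (by omega)
    rcases lt_trichotomy a b with hab | rfl | hab
    · have ht := hturn b hab (by omega)
      refine ih.imp (fun ih i h1 h2 => ?_) (fun ih i h1 h2 => ?_) <;>
      · have e1 := ih (b - 1) (by omega) (by omega)
        have e2 := ih b (by omega) (by omega)
        rcases Nat.lt_or_ge b i with h | h
        · obtain rfl : i = b + 1 := by omega
          omega
        · exact ih i h1 h
    · refine hs.imp (fun hs i h1 h2 => ?_) (fun hs i h1 h2 => ?_) <;>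
      · obtain rfl | rfl : i = a ∨ i = a + 1 := by omega
        all_goals omega
    · left
      intro i h1 h2
      obtain rfl : i = a := by omega
      simp

/-- A walk is monotone, or it is folded at an initial segment, at a final segment, or at an
inner segment of length `j` starting at `q`. -/
theorem IsWalk.linear_or_fold {m : ℕ} {w : ℕ → ℕ} (hw : IsWalk m w) :
    ((∀ i ≤ m, w i = w 0 + i) ∨ (∀ i ≤ m, w i + i = w 0)) ∨
    (∃ q, 1 ≤ q ∧ 2 * q ≤ m ∧ ∀ y ≤ q, w (q + y) = w (q - y)) ∨
    (∃ q, q < m ∧ m ≤ 2 * q ∧ ∀ y, q + y ≤ m → w (q + y) = w (q - y)) ∨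
    (∃ q j, 1 ≤ j ∧ j < q ∧ q + 2 * j < m ∧ (∀ y ≤ j, w (q + y) = w (q - y)) ∧
      ∀ y ≤ j, w (q + j + y) = w (q + j - y)) := by
  classical
  by_cases hlin : ∀ t, 0 < t → t < m → w (t - 1) ≠ w (t + 1)
  · left
    refine (hw.linear_of_no_turn le_rfl hlin).imp (fun h i hi => ?_) (fun h i hi => ?_)
    · simpa using h i (Nat.zero_le i) hi
    · simpa using h i (Nat.zero_le i) hi
  right
  push Not at hlin
  obtain ⟨s, hs0, hsm, hs⟩ := hlin
  let T : ℕ → Prop := fun t => t = 0 ∨ t = m ∨ (0 < t ∧ t < m ∧ w (t - 1) = w (t + 1))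
  have hex : ∃ j, 0 < j ∧ ∃ a, a + j ≤ m ∧ T a ∧ T (a + j) :=
    ⟨s, hs0, 0, by omega, Or.inl rfl, Or.inr (Or.inr (by simpa using ⟨hs0, hsm, hs⟩))⟩
  obtain ⟨hj0, a, haj, hTa, hTb⟩ := Nat.find_spec hex
  have hmin : ∀ a b, a < b → b ≤ m → T a → T b → Nat.find hex ≤ b - a := by
    intro a b hab hb ha hb'
    refine Nat.find_min' hex ⟨by omega, a, by omega, ha, ?_⟩
    rwa [Nat.add_sub_cancel' hab.le]
  generalize Nat.find hex = j at *
  have hrefl : ∀ t, 0 < t → t < m → T t → ∀ y ≤ j, w (t + y) = w (t - y) := by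
    intro t ht0 htm hT y hy
    have h1 := hmin 0 t ht0 htm.le (Or.inl rfl) hT
    have h2 := hmin t m htm le_rfl hT (Or.inr (Or.inl rfl))
    have right := hw.linear_of_no_turn (a := t) (b := t + j) (by omega) fun u hu hu' he => by
      have := hmin t u hu (by omega) hT (Or.inr (Or.inr ⟨by omega, by omega, he⟩))
      omega
    have left := hw.linear_of_no_turn (a := t - j) (b := t) (by omega) fun u hu hu' he => by
      have := hmin u t hu' (by omega) (Or.inr (Or.inr ⟨by omega, by omega, he⟩)) hT
      omega
    have hturn : w (t - 1) = w (t + 1) := by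
      rcases hT with h | h | h
      · omega
      · omega
      · exact h.2.2
    rcases right with right | right <;> rcases left with left | left <;>
    · have a1 := right (t + y) (by omega) (by omega)
      have a2 := right (t + 1) (by omega) (by omega)
      have b1 := left (t - y) (by omega) (by omega)
      have b2 := left (t - 1) (by omega) (by omega)
      have b3 := left t (by omega) (by omega)
      omega
  have hs' := hmin 0 s hs0 hsm.le (Or.inl rfl) (Or.inr (Or.inr ⟨hs0, hsm, hs⟩))
  rcases Nat.eq_zero_or_pos a with rfl | ha0
  · left
    rw [Nat.zero_add] at hTb
    have := hmin j m (by omega) le_rfl hTb (Or.inr (Or.inl rfl))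
    exact ⟨j, hj0, by omega, hrefl j hj0 (by omega) hTb⟩
  have h1 := hmin 0 a ha0 (by omega) (Or.inl rfl) hTa
  have ra := hrefl a ha0 (by omega) hTa
  rcases haj.eq_or_lt with hb | hb
  · right; left
    exact ⟨a, by omega, by omega, fun y hy => ra y (by omega)⟩
  have h2 := hmin (a + j) m hb le_rfl hTb (Or.inr (Or.inl rfl))
  have rb := hrefl (a + j) (by omega) hb hTb
  rcases h1.eq_or_lt with h1 | h1
  · left
    exact ⟨a, ha0, by omega, fun y hy => ra y (by omega)⟩
  rcases h2.eq_or_lt with h2 | h2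
  · right; left
    exact ⟨a + j, hb, by omega, fun y hy => rb y (by omega)⟩
  · right; right
    exact ⟨a, j, hj0, by omega, by omega, ra, rb⟩

theorem IsWalk.exists_mem_closure {n m : ℕ} (hm : m < n) {w : ℕ → ℕ} (hw : IsWalk m w)
    (hwn : ∀ i ≤ m, w i < n) :
    ∃ f ∈ Submonoid.closure (genA n), ∀ x : Fin n, (x : ℕ) ≤ m → (f x : ℕ) = w x := by
  induction m using Nat.strong_induction_on generalizing w with
  | _ m ih =>
  have tau := pathTau_mem_closure n
  rcases hw.linear_or_fold with (h | h) | ⟨q, hq, hqm, h⟩ | ⟨q, hq, hqm, h⟩ |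
      ⟨q, j, hj, hjq, hqm, h1, h2⟩
  · have h0 := hwn 0 (Nat.zero_le _)
    have hl := hwn m le_rfl
    have hm' := h m le_rfl
    refine ⟨pathTau n * (pathAlpha n (w 0) * pathTau n),
      mul_mem tau (mul_mem (pathAlpha_mem_closure h0) tau), fun x hx => ?_⟩
    change ((pathTau n (pathAlpha n (w 0) (pathTau n x)) : Fin n) : ℕ) = _
    rw [pathTau_val, pathAlpha_val h0, pathTau_val, h x hx]
    split_ifs <;> omega
  · have h0 := hwn 0 (Nat.zero_le _)
    have hm' := h m le_rfl
    refine ⟨pathAlpha n (w 0), pathAlpha_mem_closure h0, fun x hx => ?_⟩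
    have := h x hx
    rw [pathAlpha_val h0]
    split_ifs <;> omega
  · obtain ⟨g, hg, hgw⟩ := ih (m - q) (by omega) (by omega) (w := fun y => w (q + y))
      (fun i hi => hw (q + i) (by omega)) (fun i hi => hwn (q + i) (by omega))
    refine ⟨g * pathAlpha n q, mul_mem hg (pathAlpha_mem_closure (by omega)), fun x hx => ?_⟩
    change ((g (pathAlpha n q x) : Fin n) : ℕ) = _
    have hv := pathAlpha_val (n := n) (i := q) (by omega) x
    rw [hgw _ (by rw [hv]; split_ifs <;> omega), hv]
    split_ifs with hxq
    · rw [h _ (by omega), Nat.sub_sub_self hxq]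
    · rw [Nat.add_sub_cancel' (by omega)]
  · obtain ⟨g, hg, hgw⟩ := ih q hq (by omega) (w := w)
      (fun i hi => hw i (by omega)) (fun i hi => hwn i (by omega))
    refine ⟨g * (pathAlpha n (n - 1 - q) * (pathTau n * pathAlpha n q)),
      mul_mem hg (mul_mem (pathAlpha_mem_closure (by omega))
        (mul_mem tau (pathAlpha_mem_closure (by omega)))), fun x hx => ?_⟩
    change ((g (pathAlpha n (n - 1 - q) (pathTau n (pathAlpha n q x))) : Fin n) : ℕ) = _
    have hv : (pathAlpha n (n - 1 - q) (pathTau n (pathAlpha n q x)) : ℕ) =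
        if (x : ℕ) ≤ q then (x : ℕ) else q - (x - q) := by
      rw [pathAlpha_val (by omega), pathTau_val, pathAlpha_val (by omega)]
      split_ifs <;> omega
    rw [hgw _ (by rw [hv]; split_ifs <;> omega), hv]
    split_ifs with hxq
    · rfl
    · rw [← h _ (by omega), Nat.add_sub_cancel' (by omega)]
  · have hret : w (q + 2 * j) = w q := by
      have e1 := h1 j le_rfl
      have e2 := h2 j le_rfl
      rw [show q + j + j = q + 2 * j by ring, Nat.add_sub_cancel] at e2
      exact e2
    obtain ⟨g, hg, hgw⟩ := ih (m - 2 * j) (by omega) (by omega)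
      (w := fun y => if y ≤ q then w y else w (y + 2 * j))
      (fun i hi => by
        dsimp only
        rcases lt_trichotomy i q with hiq | rfl | hiq
        · rw [if_pos hiq.le, if_pos (by omega)]
          exact hw i (by omega)
        · rw [if_pos le_rfl, if_neg (by omega), ← hret, Nat.add_right_comm]
          exact hw (i + 2 * j) (by omega)
        · rw [if_neg (by omega), if_neg (by omega), Nat.add_right_comm]
          exact hw (i + 2 * j) (by omega))
      (fun i hi => by
        split_ifs
        · exact hwn i (by omega)
        · exact hwn _ (by omega))
    refine ⟨g * pathBeta n j (q - j), mul_mem hg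
      (pathBeta_mem_closure hj (by omega) (by omega)), fun x hx => ?_⟩
    change ((g (pathBeta n j (q - j) x) : Fin n) : ℕ) = _
    have hv := pathBeta_val (n := n) j (q - j) x
    rw [hgw _ (by rw [hv]; split_ifs <;> omega), hv]
    by_cases c1 : (x : ℕ) ≤ q
    · rw [if_pos (show (x : ℕ) ≤ q - j + j by omega), if_pos c1]
    rw [if_neg (show ¬ (x : ℕ) ≤ q - j + j by omega)]
    by_cases c2 : (x : ℕ) ≤ q + j
    · rw [if_pos (show (x : ℕ) ≤ q - j + 2 * j by omega), if_pos (by omega)]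
      have := h1 (x - q) (by omega)
      rw [Nat.add_sub_cancel' (by omega)] at this
      rw [this]
      congr 1
      omega
    rw [if_neg (show ¬ (x : ℕ) ≤ q - j + 2 * j by omega)]
    by_cases c3 : (x : ℕ) ≤ q + 2 * j
    · rw [if_pos (by omega)]
      have e2 := h2 (x - (q + j)) (by omega)
      have e1 := h1 (q + 2 * j - x) (by omega)
      rw [Nat.add_sub_cancel' (by omega)] at e2
      rw [e2, show q + j - ((x : ℕ) - (q + j)) = q + (q + 2 * j - x) by omega, e1]
      congr 1
      omega
    · rw [if_neg (by omega)]
      congr 1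
      omega

theorem IsEndo.mem_closure_genA {n : ℕ} {f : Function.End (Fin n)} (hf : IsEndo f) :
    f ∈ Submonoid.closure (genA n) := by
  rcases Nat.eq_zero_or_pos n with rfl | hn
  · rw [show f = 1 from funext fun x => x.elim0]
    exact one_mem _
  let w : ℕ → ℕ := fun i => if h : i < n then (f ⟨i, h⟩ : ℕ) else 0
  have hwv : ∀ i, ∀ h : i < n, w i = f ⟨i, h⟩ := fun i h => dif_pos h
  have hw : IsWalk (n - 1) w := by
    intro i hi
    have := (abs_eq zero_le_one).1 (hf i (by omega))
    rw [hwv i (by omega), hwv (i + 1) (by omega)]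
    omega
  obtain ⟨g, hg, hgw⟩ := hw.exists_mem_closure (n := n) (by omega) (fun i hi => by
    rw [hwv i (by omega)]
    exact Fin.isLt _)
  have : f = g := by
    funext x
    apply Fin.ext
    rw [hgw x (by omega), hwv x x.isLt]
  rwa [this]

theorem pathAlpha_injOn (n : ℕ) : Set.InjOn (pathAlpha n) (Set.Iio n) := by
  intro i hi k hk h
  simp only [Set.mem_Iio] at hi hk
  have := congrArg (fun f : Function.End (Fin n) => (f ⟨0, by omega⟩ : ℕ)) h
  simpa [pathAlpha_val hi, pathAlpha_val hk] using this

theorem pathBeta_inj {n j i l k : ℕ} (hji : i + 2 * j + 1 < n) (hj : 1 ≤ j)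
    (hlk : k + 2 * l + 1 < n) (hl : 1 ≤ l) (h : pathBeta n j i = pathBeta n l k) :
    j = l ∧ i = k := by
  have val : ∀ x, ∀ hx : x < n, (pathBeta n j i ⟨x, hx⟩ : ℕ) = pathBeta n l k ⟨x, hx⟩ :=
    fun x hx => by rw [h]
  simp only [pathBeta_val] at val
  obtain rfl : j = l := by
    have := val (n - 1) (by omega)
    split_ifs at this <;> omega
  refine ⟨rfl, ?_⟩
  have v1 := val (i + j + 1) (by omega)
  have v2 := val (k + j + 1) (by omega)
  split_ifs at v1 v2 <;> omega

theorem ncard_genA (n : ℕ) : (genA n).ncard =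
    1 + (n - 1) / 2 + ∑ j ∈ Finset.Icc 1 ((n - 3) / 3), (n - 3 * j - 1) / 2 := by
  have hA : {g | ∃ i, 1 ≤ i ∧ i ≤ (n - 1) / 2 ∧ g = pathAlpha n i} =
      pathAlpha n '' (Finset.Icc 1 ((n - 1) / 2) : Finset ℕ) := by
    ext g
    simp [and_assoc, eq_comm]
  let S : Finset (Σ _ : ℕ, ℕ) := (Finset.Icc 1 ((n - 3) / 3)).sigma fun j =>
    Finset.Icc 1 ((n - 3 * j - 1) / 2)
  have hB : {g | ∃ j, 1 ≤ j ∧ j ≤ (n - 3) / 3 ∧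
        ∃ i, 1 ≤ i ∧ i ≤ (n - 3 * j - 1) / 2 ∧ g = pathBeta n j i} =
      (fun p : Σ _ : ℕ, ℕ => pathBeta n p.1 p.2) '' (S : Set (Σ _ : ℕ, ℕ)) := by
    ext g
    constructor
    · rintro ⟨j, hj, hj', i, hi, hi', rfl⟩
      exact ⟨⟨j, i⟩, by simp [S, hj, hj', hi, hi'], rfl⟩
    · rintro ⟨⟨j, i⟩, hp, rfl⟩
      simp only [S, Finset.coe_sigma, Set.mem_sigma_iff, Finset.mem_coe, Finset.mem_Icc] at hp
      exact ⟨j, hp.1.1, hp.1.2, i, hp.2.1, hp.2.2, rfl⟩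
  have hAcard : (pathAlpha n '' (Finset.Icc 1 ((n - 1) / 2) : Finset ℕ)).ncard = (n - 1) / 2 := by
    rw [Set.InjOn.ncard_image, Set.ncard_coe_finset, Nat.card_Icc, Nat.add_sub_cancel]
    refine (pathAlpha_injOn n).mono fun i hi => ?_
    simp only [Finset.mem_coe, Finset.mem_Icc] at hi
    simp only [Set.mem_Iio]
    omega
  have hBcard : ((fun p : Σ _ : ℕ, ℕ => pathBeta n p.1 p.2) '' (S : Set (Σ _ : ℕ, ℕ))).ncard =
      ∑ j ∈ Finset.Icc 1 ((n - 3) / 3), (n - 3 * j - 1) / 2 := by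
    rw [Set.InjOn.ncard_image, Set.ncard_coe_finset, Finset.card_sigma]
    · simp only [Nat.card_Icc, Nat.add_sub_cancel]
    · rintro ⟨j, i⟩ hp ⟨l, k⟩ hq h
      simp only [S, Finset.mem_coe, Finset.mem_sigma, Finset.mem_Icc] at hp hq
      obtain ⟨rfl, rfl⟩ := pathBeta_inj (n := n) (j := j) (i := i) (l := l) (k := k)
        (by omega) (by omega) (by omega) (by omega) h
      rfl
  have val0 : ∀ {f g : Function.End (Fin n)} (hn : 0 < n), f = g →
      (f ⟨0, hn⟩ : ℕ) = g ⟨0, hn⟩ := fun _ h => by rw [h]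
  have : Finite (Function.End (Fin n)) := inferInstanceAs (Finite (Fin n → Fin n))
  unfold genA
  rw [Set.ncard_union_eq ?_ (Set.toFinite _) (Set.toFinite _),
    Set.ncard_union_eq ?_ (Set.toFinite _) (Set.toFinite _), Set.ncard_singleton,
    hA, hB, hAcard, hBcard]
  · rw [Set.disjoint_left]
    rintro _ rfl ⟨i, hi, hi', h⟩
    have := val0 (by omega) h
    rw [pathTau_val, pathAlpha_val (by omega)] at this
    simp at this
    omega
  · rw [Set.disjoint_left]
    rintro g hg ⟨j, hj, hj', i, hi, hi', rfl⟩
    rcases hg with h | ⟨k, hk, hk', h⟩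
    · have := val0 (by omega) h
      rw [pathTau_val, pathBeta_val] at this
      simp at this
      omega
    · have := val0 (by omega) h
      rw [pathAlpha_val (by omega), pathBeta_val] at this
      simp at this
      omega

/-- The set `A` generates the monoid `End P_n`, and
`|A| = 1 + ⌊(n-1)/2⌋ + ∑_{j=1}^{⌊(n-3)/3⌋} ⌊(n-3j-1)/2⌋`. -/
theorem genA_generates_End_path (n : ℕ) :
    (Submonoid.closure (genA n) : Set (Function.End (Fin n))) = {f | IsEndo f} ∧
    (genA n).ncard =
      1 + (n - 1) / 2 + ∑ j ∈ Finset.Icc 1 ((n - 3) / 3), (n - 3 * j - 1) / 2 :=  by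
  exact ⟨Set.ext fun _ => ⟨isEndo_of_mem_closure_genA, IsEndo.mem_closure_genA⟩, ncard_genA n⟩
end
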